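/- arXiv:math/0105136 — 2 statements merged into one kernel-verified Lean document; each statement's English description precedes it below -/
import Mathlib

section
/- If T is stable and acl(∅) = dcl(∅) in C^eq_T, then T_σ has the joint embedding property: any two models of T_σ embed into a common model of T_σ. -/
namespace PaperAut

open FirstOrder Language Structure Set

/-- The language with a single unary function symbol `σ` and nothing else. -/
def sigmaFuncs : ℕ → Type
  | 1 => Unit
  | _ => Empty

def sigmaLang : FirstOrder.Language := ⟨sigmaFuncs, fun _ => Empty⟩

/-- `L_σ`: the language `L` together with a new unary function symbol `σ`. -/
abbrev Lsig (L : FirstOrder.Language) : FirstOrder.Language := L.sum sigmaLang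

/-- The new unary function symbol `σ`. -/
def sigSymb : sigmaLang.Functions 1 := (⟨⟩ : Unit)

variable (L : FirstOrder.Language)

/-- The interpretation of the symbol `σ` in an `L_σ`-structure. -/
def sigmaMap (M : Type*) [(Lsig L).Structure M] : M → M :=
  fun x => Structure.funMap (L := Lsig L) (Sum.inr sigSymb) ![x]

/-- The `L`-reduct structure of an `L_σ`-structure. -/
def redL (M : Type*) [(Lsig L).Structure M] : L.Structure M :=
  (LHom.sumInl : L →ᴸ Lsig L).reduct M

/-- `M` is a model of `T_σ`: its `L`-reduct models `T` and `σ` is an `L`-automorphism. -/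
def IsTsigmaModel (T : L.Theory) (M : Type*) [(Lsig L).Structure M] : Prop :=
  (letI := redL L M; M ⊨ T) ∧
  Function.Bijective (sigmaMap L M) ∧
  (letI := redL L M;
    ∀ (r : ℕ) (R : L.Relations r) (x : Fin r → M),
      Structure.RelMap R (sigmaMap L M ∘ x) ↔ Structure.RelMap R x)

/-- A set of `L`-formulas, each with `m` designated type-variables and `k`
parameter-variables. -/
abbrev FmlSet : Type _ := Set ((m : ℕ) × (k : ℕ) × L.Formula (Fin m ⊕ Fin k))

variable {L}

/-- Concatenation of `l` many `p`-tuples of a sequence, selected by `s`. -/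
def seqConcat {M : Type*} {p l : ℕ} (e : ℕ → Fin p → M) (s : Fin l → ℕ) :
    Fin (l * p) → M :=
  fun j => e (s (finProdFinEquiv.symm j).1) ((finProdFinEquiv.symm j).2)

/-- The sequence `⟨e_i : i ∈ Dom⟩` of `p`-tuples is `Δ`-indiscernible over the tuple `a`:
any two properly ordered subsequences of equal length realize the same `Δ`-formulas with
parameters from `a`. -/
def DeltaIndisc (Δ : FmlSet L) {M : Type*} [L.Structure M] {p q : ℕ}
    (e : ℕ → Fin p → M) (Dom : Set ℕ) (a : Fin q → M) : Prop :=
  ∀ (m k : ℕ) (φ : L.Formula (Fin m ⊕ Fin k)),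
    (⟨m, k, φ⟩ : (m : ℕ) × (k : ℕ) × L.Formula (Fin m ⊕ Fin k)) ∈ Δ →
    ∀ (l : ℕ) (h : m = l * p) (s t : Fin l → ℕ),
      StrictMono s → StrictMono t → (∀ j, s j ∈ Dom) → (∀ j, t j ∈ Dom) →
      ∀ d : Fin k → M, (∀ j, d j ∈ Set.range a) →
        (φ.Realize (Sum.elim (seqConcat e s ∘ Fin.cast h) d) ↔
          φ.Realize (Sum.elim (seqConcat e t ∘ Fin.cast h) d))

/-- Concatenation of three `n`-tuples into a `3n`-tuple. -/
def tripleTup {M : Type*} {n : ℕ} (x y z : Fin n → M) : Fin (3 * n) → M :=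
  fun j => Fin.append (Fin.append x y) z (Fin.cast (by ring) j)

/-- Extend a finite sequence of tuples to an `ℕ`-indexed one (junk values beyond). -/
noncomputable def padSeq {M : Type*} [Nonempty M] {p r : ℕ} (e : Fin r → Fin p → M) :
    ℕ → Fin p → M :=
  fun i => if h : i < r then e ⟨i, h⟩ else fun _ => Classical.arbitrary M

/-- The `Δ`-averages (in the sense of Shelah: formulas satisfied by at least `f(Δ,n)/10`
members of the sequence) of the two sequences of `n`-tuples, with parameters from `P`,
are equal. -/
def AvgEqOn (f : FmlSet L → ℕ → ℕ) (Δ : FmlSet L) {M : Type*} [L.Structure M] {n : ℕ}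
    (K₁ K₂ : ℕ) (e₁ e₂ : ℕ → Fin n → M) (P : Set M) : Prop :=
  ∀ (m k : ℕ) (φ : L.Formula (Fin m ⊕ Fin k)),
    (⟨m, k, φ⟩ : (m : ℕ) × (k : ℕ) × L.Formula (Fin m ⊕ Fin k)) ∈ Δ →
    ∀ (h : m = n) (d : Fin k → M), (∀ j, d j ∈ P) →
      (f Δ n ≤ 10 * Nat.card {i : Fin K₁ // φ.Realize (Sum.elim (e₁ i ∘ Fin.cast h) d)} ↔
        f Δ n ≤ 10 * Nat.card {i : Fin K₂ // φ.Realize (Sum.elim (e₂ i ∘ Fin.cast h) d)})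

/-- `τ_Δ`: `z` together with some strictly increasing subsequence of `⟨e_i : i ∈ S⟩` of
length `r` forms a `Δ`-indiscernible sequence over `a`. -/
def TauSem (Δ : FmlSet L) {M : Type*} [L.Structure M] [Nonempty M] {p q : ℕ} (r : ℕ)
    (e : ℕ → Fin p → M) (S : Set ℕ) (a : Fin q → M) (z : Fin p → M) : Prop :=
  ∃ s : Fin r → ℕ, StrictMono s ∧ (∀ j, s j ∈ S) ∧
    DeltaIndisc Δ (padSeq (Fin.snoc (fun j => e (s j)) z)) (Set.Iio (r + 1)) a

variable (L)

/-- `⟨b̄ᵢ σ(b̄ᵢ) c̄ᵢ : i < K⟩ā` is a `(σ,Δ₁,Δ₂,Δ₃,n)`-obstruction over `A`. -/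
def IsObstruction (F : FmlSet L → ℕ → FmlSet L) (f : FmlSet L → ℕ → ℕ)
    (Δ₁ Δ₂ Δ₃ : FmlSet L) (n : ℕ) {M : Type*} [L.Structure M] [Nonempty M]
    (σ : M → M) (A : Set M) {q : ℕ} (a : Fin q → M)
    (K : ℕ) (b c : ℕ → Fin n → M) : Prop :=
  DeltaIndisc (F Δ₂ (3 * n)) (fun i => tripleTup (b i) (σ ∘ b i) (c i)) (Set.Iio K) a
  ∧ f Δ₂ (3 * n) ≤ K
  ∧ AvgEqOn f Δ₂ K K (fun i => σ ∘ b i) c Set.univ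
  ∧ ∀ x x' y : Fin n → M,
      TauSem Δ₁ (f Δ₁ (3 * n)) (fun i => tripleTup (b i) (σ ∘ b i) (c i)) (Set.Iio K) a
        (tripleTup x x' y) →
      ∃ (m k : ℕ) (φ : L.Formula (Fin m ⊕ Fin k)),
        (⟨m, k, φ⟩ : (m : ℕ) × (k : ℕ) × L.Formula (Fin m ⊕ Fin k)) ∈ Δ₃ ∧
        ∃ (h : m = n) (d : Fin k → M),
          (∀ j, d j ∈ A ∪ (⋃ i ∈ Set.Iio K, Set.range (tripleTup (b i) (σ ∘ b i) (c i)))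
              ∪ Set.range a) ∧
          φ.Realize (Sum.elim (x' ∘ Fin.cast h) d) ∧ ¬ φ.Realize (Sum.elim (y ∘ Fin.cast h) d)


variable (L : FirstOrder.Language)

/-- `T` has the order property (some formula orders arbitrarily long finite sequences). -/
def HasOrderProp (T : L.Theory) : Prop :=
  ∃ (n m : ℕ) (φ : L.Formula (Fin n ⊕ Fin m)), ∀ N : ℕ,
    ∃ (M : Type) (_ : L.Structure M) (a : Fin N → Fin n → M) (b : Fin N → Fin m → M),
      Nonempty M ∧ (M ⊨ T) ∧ ∀ i j : Fin N, φ.Realize (Sum.elim (a i) (b j)) ↔ i ≤ j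

/-- `T` is stable: no formula has the order property. -/
def IsStable (T : L.Theory) : Prop := ¬ HasOrderProp L T

/-- `T` has the finite cover property: some formula `E(x̄,ȳ,z̄)` defines, for each value of
`z̄`, an equivalence relation, and for each `n` some instance has finitely many but more
than `n` classes. -/
def HasFCP (T : L.Theory) : Prop :=
  ∃ (r m : ℕ) (E : L.Formula ((Fin r ⊕ Fin r) ⊕ Fin m)),
    (∀ (M : Type) [L.Structure M] [Nonempty M], M ⊨ T → ∀ d : Fin m → M,
      Equivalence (fun x y : Fin r → M => E.Realize (Sum.elim (Sum.elim x y) d))) ∧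
    ∀ n : ℕ, ∃ (M : Type) (_ : L.Structure M), Nonempty M ∧ (M ⊨ T) ∧
      ∃ (d : Fin m → M) (k : ℕ), n < k ∧
        ∃ reps : Fin k → Fin r → M,
          (∀ i j : Fin k, i ≠ j → ¬ E.Realize (Sum.elim (Sum.elim (reps i) (reps j)) d)) ∧
          (∀ x : Fin r → M, ∃ i, E.Realize (Sum.elim (Sum.elim x (reps i)) d))

/-- A theory is model complete if every embedding between its models is elementary. -/
def IsModelComplete {L' : FirstOrder.Language} (T' : L'.Theory) : Prop :=
  ∀ (M N : Type) [L'.Structure M] [L'.Structure N] [Nonempty M] [Nonempty N],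
    M ⊨ T' → N ⊨ T' →
      ∀ (g : M ↪[L'] N) (k : ℕ) (φ : L'.Formula (Fin k)) (x : Fin k → M),
        φ.Realize (g ∘ x) ↔ φ.Realize x


/-- `T'` is a model companion of `T_σ`: `T'` is model complete and mutually
model-consistent with `T_σ`. -/
def IsModelCompanionTsigma (T : L.Theory) (T' : (Lsig L).Theory) : Prop :=
  IsModelComplete T' ∧
  (∀ (M : Type) [(Lsig L).Structure M] [Nonempty M], IsTsigmaModel L T M →
    ∃ (N : Type) (_ : (Lsig L).Structure N), Nonempty N ∧ (N ⊨ T') ∧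
      Nonempty (M ↪[Lsig L] N)) ∧
  (∀ (N : Type) [(Lsig L).Structure N] [Nonempty N], N ⊨ T' →
    ∃ (M : Type) (_ : (Lsig L).Structure M), Nonempty M ∧ IsTsigmaModel L T M ∧
      Nonempty (N ↪[Lsig L] M))

/-- `T_σ` has a model companion. -/
def HasModelCompanionTsigma (T : L.Theory) : Prop :=
  ∃ T' : (Lsig L).Theory, IsModelCompanionTsigma L T T'

/-- `M` is an existentially closed model of `T_σ`. -/
def IsECTsigma (T : L.Theory) (M : Type) [(Lsig L).Structure M] : Prop :=
  Nonempty M ∧ IsTsigmaModel L T M ∧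
  ∀ (N : Type) [(Lsig L).Structure N] [Nonempty N], IsTsigmaModel L T N →
    ∀ (g : M ↪[Lsig L] N) (k l : ℕ) (φ : (Lsig L).BoundedFormula (Fin k) l),
      φ.IsQF → ∀ a : Fin k → M,
        (∃ y : Fin l → N, φ.Realize (g ∘ a) y) → ∃ y : Fin l → M, φ.Realize a y

/-- The pair of functions `Δ, n ↦ F(Δ,n)` and `Δ, n ↦ f(Δ,n)` has the properties furnished
by stability of `T` (Shelah II.2.17, II.4.13): `F(Δ,n) ⊇ Δ` is finite for finite `Δ`, both
functions are increasing, and on any `F(Δ,n)`-indiscernible sequence of `n`-tuples of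
length at least `f(Δ,n)`, each `Δ`-formula with parameters holds on fewer than `f(Δ,n)/2`
members or fails on fewer than `f(Δ,n)/2` members. -/
def GoodFf (T : L.Theory) (F : FmlSet L → ℕ → FmlSet L) (f : FmlSet L → ℕ → ℕ) : Prop :=
  (∀ (Δ : FmlSet L) (n : ℕ), Δ ⊆ F Δ n) ∧
  (∀ (Δ : FmlSet L) (n : ℕ), Δ.Finite → (F Δ n).Finite) ∧
  (∀ (Δ Δ' : FmlSet L) (n n' : ℕ), Δ ⊆ Δ' → n ≤ n' → F Δ n ⊆ F Δ' n' ∧ f Δ n ≤ f Δ' n') ∧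
  (∀ (Δ : FmlSet L) (n : ℕ), 0 < f Δ n) ∧
  (∀ (Δ : FmlSet L) (n : ℕ) (M : Type) (_ : L.Structure M) (_ : Nonempty M),
    M ⊨ T → ∀ (K : ℕ) (e : ℕ → Fin n → M), f Δ n ≤ K →
      DeltaIndisc (F Δ n) e (Set.Iio K) (fun i : Fin 0 => i.elim0) →
      ∀ (m k : ℕ) (φ : L.Formula (Fin m ⊕ Fin k)),
        (⟨m, k, φ⟩ : (m : ℕ) × (k : ℕ) × L.Formula (Fin m ⊕ Fin k)) ∈ Δ →
        ∀ (h : m = n) (d : Fin k → M),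
          2 * Nat.card {i : Fin K // φ.Realize (Sum.elim (e i ∘ Fin.cast h) d)} < f Δ n ∨
          2 * Nat.card {i : Fin K // ¬ φ.Realize (Sum.elim (e i ∘ Fin.cast h) d)} < f Δ n)

/-- `T_σ` has obstructions: for some finite `Δ₁` and `n`, every finite `Δ₂ ⊇ F(Δ₁,3n)`
admits an obstruction in some model of `T_σ`. -/
def TheoryHasObstructions (T : L.Theory) (F : FmlSet L → ℕ → FmlSet L)
    (f : FmlSet L → ℕ → ℕ) : Prop :=
  ∃ (Δ₁ : FmlSet L) (n : ℕ), Δ₁.Finite ∧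
    ∀ Δ₂ : FmlSet L, Δ₂.Finite → F Δ₁ (3 * n) ⊆ Δ₂ →
      ∃ (Δ₃ : FmlSet L), Δ₃.Finite ∧
        ∃ (M : Type) (_ : (Lsig L).Structure M) (_ : Nonempty M), IsTsigmaModel L T M ∧
          ∃ (A : Set M), A.Finite ∧
            ∃ (q : ℕ) (a : Fin q → M) (K : ℕ) (b c : ℕ → Fin n → M),
              (∀ j, a j ∈ A) ∧
              (letI := redL L M;
                IsObstruction L F f Δ₁ Δ₂ Δ₃ n (sigmaMap L M) A a K b c)

/-- `T` has simple obstructions: obstructions with respect to the identity automorphism,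
in plain models of `T`. -/
def TheoryHasSimpleObstructions (T : L.Theory) (F : FmlSet L → ℕ → FmlSet L)
    (f : FmlSet L → ℕ → ℕ) : Prop :=
  ∃ (Δ₁ : FmlSet L) (n : ℕ), Δ₁.Finite ∧
    ∀ Δ₂ : FmlSet L, Δ₂.Finite → F Δ₁ (3 * n) ⊆ Δ₂ →
      ∃ (Δ₃ : FmlSet L), Δ₃.Finite ∧
        ∃ (M : Type) (_ : L.Structure M) (_ : Nonempty M), (M ⊨ T) ∧
          ∃ (A : Set M), A.Finite ∧
            ∃ (q : ℕ) (a : Fin q → M) (K : ℕ) (b c : ℕ → Fin n → M),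
              (∀ j, a j ∈ A) ∧
              IsObstruction L F f Δ₁ Δ₂ Δ₃ n (id : M → M) A a K b c

/-- `T_σ` has no `σ`-obstructions: there is a function `G(Δ₁,n) ⊇ F(Δ₁,3n)`, independent
of the model, such that no model of `T_σ` contains a `(σ,Δ₁,G(Δ₁,n),Δ₃,n)`-obstruction
over a finite set. -/
def TsigmaNoObstructions (T : L.Theory) (F : FmlSet L → ℕ → FmlSet L)
    (f : FmlSet L → ℕ → ℕ) : Prop :=
  ∃ G : FmlSet L → ℕ → FmlSet L,
    (∀ (Δ₁ : FmlSet L) (n : ℕ), F Δ₁ (3 * n) ⊆ G Δ₁ n ∧ (Δ₁.Finite → (G Δ₁ n).Finite)) ∧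
    ∀ (M : Type) [(Lsig L).Structure M] [Nonempty M], IsTsigmaModel L T M →
      ∀ (Δ₁ Δ₃ : FmlSet L), Δ₁.Finite → Δ₃.Finite →
        ∀ (n : ℕ) (A : Set M), A.Finite →
          ∀ (q : ℕ) (a : Fin q → M) (K : ℕ) (b c : ℕ → Fin n → M), (∀ j, a j ∈ A) →
            (letI := redL L M;
              ¬ IsObstruction L F f Δ₁ (G Δ₁ n) Δ₃ n (sigmaMap L M) A a K b c)


/-- `E(x̄,ȳ)` is a finite equivalence relation of `T`: in every model of `T` it defines an
equivalence relation on `r`-tuples with finitely many classes. -/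
def FiniteEqRel (T : L.Theory) (r : ℕ) (E : L.Formula (Fin r ⊕ Fin r)) : Prop :=
  ∀ (M : Type) [L.Structure M] [Nonempty M], M ⊨ T →
    Equivalence (fun x y : Fin r → M => E.Realize (Sum.elim x y)) ∧
    ∃ (N : ℕ) (reps : Fin N → Fin r → M),
      ∀ x : Fin r → M, ∃ i, E.Realize (Sum.elim x (reps i))

/-- `acl(∅) = dcl(∅)` in `C^eq_T`: every finite equivalence relation of `T` is defined by
a finite conjunction `⋀ᵢ (φᵢ(x̄) ↔ φᵢ(ȳ))`. -/
def AclEqDcl (T : L.Theory) : Prop :=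
  ∀ (r : ℕ) (E : L.Formula (Fin r ⊕ Fin r)), FiniteEqRel L T r E →
    ∃ (l : ℕ) (φs : Fin l → L.Formula (Fin r)),
      ∀ (M : Type) [L.Structure M] [Nonempty M], M ⊨ T →
        ∀ x y : Fin r → M,
          E.Realize (Sum.elim x y) ↔ ∀ i, ((φs i).Realize x ↔ (φs i).Realize y)

universe u v

section Uniform

variable {L : FirstOrder.Language.{u, v}}

/-- A property of tuples is uniformly first-order if a single formula defines it in every
nonempty structure. -/
def UniformFO {α : Type} (Q : ∀ (M : Type) [L.Structure M], (α → M) → Prop) : Prop :=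
  ∃ ψ : L.Formula α, ∀ (M : Type) [L.Structure M] [Nonempty M] (v : α → M),
    ψ.Realize v ↔ Q M v

/-- A formula in two groups of variables uses only finitely many variables of each group. -/
theorem exists_finite_variables {X Y : Type} (φ : L.Formula (X ⊕ Y)) :
    ∃ (n m : ℕ) (i : Fin n → X) (j : Fin m → Y) (φ₀ : L.Formula (Fin n ⊕ Fin m)),
      Function.Injective i ∧ Function.Injective j ∧
      ∀ (M : Type) [L.Structure M] (v : X ⊕ Y → M),
        φ.Realize v ↔ φ₀.Realize (v ∘ Sum.map i j) := by
  classical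
  let s := BoundedFormula.freeVarFinset φ
  let f : s → Fin s.toLeft.card ⊕ Fin s.toRight.card := fun a =>
    match a with
    | ⟨Sum.inl x, h⟩ => Sum.inl (s.toLeft.equivFin ⟨x, by simpa using h⟩)
    | ⟨Sum.inr y, h⟩ => Sum.inr (s.toRight.equivFin ⟨y, by simpa using h⟩)
  refine ⟨_, _, fun a => (s.toLeft.equivFin.symm a : X), fun a => (s.toRight.equivFin.symm a : Y),
    BoundedFormula.restrictFreeVar φ f, ?_, ?_, ?_⟩
  · exact Subtype.val_injective.comp (Equiv.injective _)
  · exact Subtype.val_injective.comp (Equiv.injective _)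
  · intro M _ v
    refine (BoundedFormula.realize_restrictFreeVar v ?_).symm
    rintro ⟨x | y, h⟩ <;> simp [f]

namespace UniformFO

variable {α β : Type}

theorem of_formula (ψ : L.Formula α) : UniformFO (L := L) fun _ _ v => ψ.Realize v :=
  ⟨ψ, fun _ _ _ _ => Iff.rfl⟩

theorem congr {Q R : ∀ (M : Type) [L.Structure M], (α → M) → Prop} (hQ : UniformFO Q)
    (h : ∀ (M : Type) [L.Structure M] [Nonempty M] (v : α → M), Q M v ↔ R M v) : UniformFO R :=
  let ⟨ψ, hψ⟩ := hQ
  ⟨ψ, fun M _ _ v => (hψ M v).trans (h M v)⟩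

theorem relabel {Q : ∀ (M : Type) [L.Structure M], (α → M) → Prop} (hQ : UniformFO Q)
    (f : α → β) : UniformFO (L := L) fun M _ (v : β → M) => Q M (v ∘ f) :=
  let ⟨ψ, hψ⟩ := hQ
  ⟨ψ.relabel f, fun M _ _ v => by rw [Formula.realize_relabel, hψ]⟩

theorem not {Q : ∀ (M : Type) [L.Structure M], (α → M) → Prop} (hQ : UniformFO Q) :
    UniformFO (L := L) fun M _ (v : α → M) => ¬ Q M v :=
  let ⟨ψ, hψ⟩ := hQ
  ⟨ψ.not, fun M _ _ v => by rw [Formula.realize_not, hψ]⟩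

theorem and {Q R : ∀ (M : Type) [L.Structure M], (α → M) → Prop} (hQ : UniformFO Q)
    (hR : UniformFO R) : UniformFO (L := L) fun M _ (v : α → M) => Q M v ∧ R M v :=
  let ⟨ψ, hψ⟩ := hQ
  let ⟨χ, hχ⟩ := hR
  ⟨ψ ⊓ χ, fun M _ _ v => by rw [Formula.realize_inf, hψ, hχ]⟩

theorem iff {Q R : ∀ (M : Type) [L.Structure M], (α → M) → Prop} (hQ : UniformFO Q)
    (hR : UniformFO R) : UniformFO (L := L) fun M _ (v : α → M) => (Q M v ↔ R M v) :=
  let ⟨ψ, hψ⟩ := hQ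
  let ⟨χ, hχ⟩ := hR
  ⟨ψ.iff χ, fun M _ _ v => by rw [Formula.realize_iff, hψ, hχ]⟩

theorem imp {Q R : ∀ (M : Type) [L.Structure M], (α → M) → Prop} (hQ : UniformFO Q)
    (hR : UniformFO R) : UniformFO (L := L) fun M _ (v : α → M) => (Q M v → R M v) :=
  let ⟨ψ, hψ⟩ := hQ
  let ⟨χ, hχ⟩ := hR
  ⟨ψ.imp χ, fun M _ _ v => by rw [Formula.realize_imp, hψ, hχ]⟩

theorem const (P : Prop) : UniformFO (L := L) fun M _ (_ : α → M) => P := by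
  by_cases h : P
  · exact ⟨⊤, fun M _ _ v => by simp [h]⟩
  · exact ⟨⊥, fun M _ _ v => by simp [h]⟩

theorem forall_finite {κ : Type*} [Finite κ]
    {Q : κ → ∀ (M : Type) [L.Structure M], (α → M) → Prop}
    (hQ : ∀ k, UniformFO (Q k)) : UniformFO (L := L) fun M _ (v : α → M) => ∀ k, Q k M v := by
  choose ψ hψ using hQ
  exact ⟨Formula.iInf ψ, fun M _ _ v => by simp [hψ]⟩

theorem exists_finite {κ : Type*} [Finite κ]
    {Q : κ → ∀ (M : Type) [L.Structure M], (α → M) → Prop}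
    (hQ : ∀ k, UniformFO (Q k)) : UniformFO (L := L) fun M _ (v : α → M) => ∃ k, Q k M v := by
  choose ψ hψ using hQ
  exact ⟨Formula.iSup ψ, fun M _ _ v => by simp [hψ]⟩

theorem exists_tuple {Q : ∀ (M : Type) [L.Structure M], (α ⊕ β → M) → Prop} (hQ : UniformFO Q) :
    UniformFO (L := L) fun M _ (v : α → M) => ∃ w : β → M, Q M (Sum.elim v w) := by
  obtain ⟨ψ, hψ⟩ := hQ
  obtain ⟨n, m, i, j, ψ₀, -, hj, h⟩ := exists_finite_variables ψ
  refine ⟨(ψ₀.relabel (Sum.map i id)).iExs (Fin m), fun M _ _ v => ?_⟩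
  simp only [Formula.realize_iExs, Formula.realize_relabel, ← hψ, h]
  constructor
  · rintro ⟨w, hw⟩
    refine ⟨Function.extend j w fun _ => Classical.arbitrary M, ?_⟩
    convert hw using 1
    ext (a | b) <;> simp [hj.extend_apply]
  · rintro ⟨w, hw⟩
    refine ⟨w ∘ j, ?_⟩
    convert hw using 1
    ext (a | b) <;> simp

theorem forall_tuple {Q : ∀ (M : Type) [L.Structure M], (α ⊕ β → M) → Prop} (hQ : UniformFO Q) :
    UniformFO (L := L) fun M _ (v : α → M) => ∀ w : β → M, Q M (Sum.elim v w) :=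
  hQ.not.exists_tuple.not.congr fun M _ _ v => by simp

/-- Uniformly first-order properties without free variables agree in all models of a complete
theory. -/
theorem transfer {T : L.Theory} (hT : T.IsComplete)
    {Q : ∀ (M : Type) [L.Structure M], Prop}
    (hQ : UniformFO (L := L) fun M _ (_ : Empty → M) => Q M)
    (M N : Type) [L.Structure M] [L.Structure N] [Nonempty M] [Nonempty N]
    (hM : M ⊨ T) (hN : N ⊨ T) (h : Q M) : Q N := by
  obtain ⟨ψ, hψ⟩ := hQ
  have e (K : Type) [L.Structure K] [Nonempty K] (hK : K ⊨ T) :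
      Q K ↔ T ⊨ᵇ (ψ : L.Sentence) := by
    rw [← hT.realize_sentence_iff ψ K]
    exact (hψ K default).symm
  exact (e N hN).2 ((e M hM).1 h)

end UniformFO
end Uniform

section Compactness
variable {L : FirstOrder.Language.{u, v}}

theorem small_formula [Countable L.Symbols] (X : Type) : Small.{0} (L.Formula X) := by
  have h1 : Function.Injective fun φ : L.Formula X =>
      (⟨0, φ⟩ : Σ n, L.BoundedFormula X n) := fun a b h => by simpa using h
  have : Small.{0} (Σ n, L.BoundedFormula X n) := by
    rw [Cardinal.small_iff_lift_mk_lt_univ]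
    refine lt_of_le_of_lt (Cardinal.lift_le.2 BoundedFormula.card_le) ?_
    have hL : L.card ≤ Cardinal.aleph0 := Cardinal.mk_le_aleph0
    have : max Cardinal.aleph0 (Cardinal.lift.{max u v} (Cardinal.mk X) +
        Cardinal.lift.{0} L.card) ≤
        Cardinal.lift.{max u v} (max Cardinal.aleph0 (Cardinal.mk X)) := by
      rw [Cardinal.lift_max, Cardinal.lift_aleph0]
      refine max_le (le_max_left _ _) ?_
      refine (Cardinal.add_le_max _ _).trans (max_le (max_le (le_max_right _ _) ?_) (le_max_left _ _))
      exact le_max_of_le_left (by simpa using hL)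
    refine lt_of_le_of_lt (Cardinal.lift_le.2 this) ?_
    rw [Cardinal.lift_lift]
    exact Cardinal.lift_lt_univ' _
  exact small_of_injective h1

/-- Compactness for types over a theory in a countable language, keeping all models in `Type`. -/
theorem exists_realization [Countable L.Symbols] (T : L.Theory) {X : Type}
    (Φ : Set (L.Formula X))
    (h : ∀ Φ₀ : Finset (L.Formula X), (Φ₀ : Set (L.Formula X)) ⊆ Φ →
      ∃ (M : Type) (_ : L.Structure M) (_ : Nonempty M) (_ : M ⊨ T) (v : X → M),
        ∀ φ ∈ Φ₀, φ.Realize v) :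
    ∃ (M : Type) (_ : L.Structure M) (_ : Nonempty M) (_ : M ⊨ T) (v : X → M),
      ∀ φ ∈ Φ, φ.Realize v := by
  classical
  have : Small.{0} (L.Formula X) := small_formula X
  let J := Shrink.{0} Φ
  let F : Finset J → Finset (L.Formula X) := fun s =>
    s.image fun j => ((equivShrink Φ).symm j : L.Formula X)
  have hF (s : Finset J) : (F s : Set (L.Formula X)) ⊆ Φ := by
    intro φ hφ
    simp only [F, Finset.coe_image, Set.mem_image] at hφ
    obtain ⟨j, -, rfl⟩ := hφ
    exact ((equivShrink Φ).symm j).2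
  choose M sM nM hM v hv using fun s => h (F s) (hF s)
  let U : Ultrafilter (Finset J) := Ultrafilter.of Filter.atTop
  refine ⟨(U : Filter (Finset J)).Product M, inferInstance, inferInstance, ?_,
    fun x => ((fun s => v s x : ∀ s, M s) : (U : Filter (Finset J)).Product M), ?_⟩
  · refine ⟨fun φ hφ => ?_⟩
    rw [Ultraproduct.sentence_realize]
    exact Filter.Eventually.of_forall fun s => (hM s).realize_of_mem φ hφ
  · intro φ hφ
    refine (Ultraproduct.realize_formula_cast (u := U) (M := M) φ fun x s => v s x).2 ?_
    have : ∀ᶠ s in Filter.atTop, ({equivShrink Φ ⟨φ, hφ⟩} : Finset J) ≤ s :=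
      Filter.eventually_ge_atTop _
    refine Filter.Eventually.mono (Ultrafilter.of_le Filter.atTop this) fun s hs => hv s φ ?_
    simp only [F, Finset.mem_image]
    exact ⟨_, hs (Finset.mem_singleton_self _), by simp⟩

end Compactness

section Trees

variable {A C : Type*}

/-- `S` carries a complete binary tree of height `k`, whose nodes are labelled by elements of `P`
and whose branching is decided by the relation `Q`. -/
def SplitTree (Q : A → C → Prop) (P : Set C) : ℕ → Set A → Prop
  | 0, S => S.Nonempty
  | k + 1, S => ∃ c ∈ P, SplitTree Q P k (S ∩ {x | Q x c}) ∧ SplitTree Q P k (S ∩ {x | ¬ Q x c})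

theorem SplitTree.mono {Q : A → C → Prop} {P : Set C} {k : ℕ} {S S' : Set A} (hS : S ⊆ S')
    (h : SplitTree Q P k S) : SplitTree Q P k S' := by
  induction k generalizing S S' with
  | zero => exact Set.Nonempty.mono hS h
  | succ k ih =>
    obtain ⟨c, hc, h1, h2⟩ := h
    exact ⟨c, hc, ih (inter_subset_inter_left _ hS) h1, ih (inter_subset_inter_left _ hS) h2⟩

theorem SplitTree.nonempty {Q : A → C → Prop} {P : Set C} {k : ℕ} {S : Set A}
    (h : SplitTree Q P k S) : S.Nonempty := by
  induction k generalizing S with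
  | zero => exact h
  | succ k ih =>
    obtain ⟨c, -, h1, -⟩ := h
    exact (ih h1).mono inter_subset_left

theorem SplitTree.of_union {Q : A → C → Prop} {P₁ P₂ : Set C} {k₁ k₂ : ℕ} {S : Set A}
    (h : SplitTree Q (P₁ ∪ P₂) (k₁ + k₂) S) : SplitTree Q P₁ k₁ S ∨ SplitTree Q P₂ k₂ S := by
  induction hn : k₁ + k₂ generalizing k₁ k₂ S with
  | zero =>
    obtain ⟨rfl, rfl⟩ : k₁ = 0 ∧ k₂ = 0 := by omega
    exact Or.inl h.nonempty
  | succ n ih =>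
    rcases k₁ with _ | k₁
    · exact Or.inl h.nonempty
    rcases k₂ with _ | k₂
    · exact Or.inr h.nonempty
    rw [hn] at h
    obtain ⟨c, hc, h1, h2⟩ := h
    rcases hc with hc | hc
    · have e : k₁ + (k₂ + 1) = n := by omega
      rw [← e] at h1 h2
      rcases ih h1 e with h1 | h1
      · rcases ih h2 e with h2 | h2
        · exact Or.inl ⟨c, hc, h1, h2⟩
        · exact Or.inr (h2.mono inter_subset_left)
      · exact Or.inr (h1.mono inter_subset_left)
    · have e : (k₁ + 1) + k₂ = n := by omega
      rw [← e] at h1 h2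
      rcases ih h1 e with h1 | h1
      · exact Or.inl (h1.mono inter_subset_left)
      · rcases ih h2 e with h2 | h2
        · exact Or.inl (h2.mono inter_subset_left)
        · exact Or.inr ⟨c, hc, h1, h2⟩

theorem SplitTree.of_biUnion {κ : Type*} (F : Finset κ) {Q : A → C → Prop} {P : κ → Set C}
    {K : κ → ℕ} {S : Set A} (h : SplitTree Q (⋃ i ∈ F, P i) (∑ i ∈ F, K i + 1) S) :
    ∃ i ∈ F, SplitTree Q (P i) (K i) S := by
  classical
  induction F using Finset.induction_on generalizing S with
  | empty =>
    obtain ⟨c, hc, -⟩ := h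
    simp at hc
  | insert i F hi ih =>
    rw [Finset.sum_insert hi, add_assoc, Finset.set_biUnion_insert] at h
    rcases h.of_union with h | h
    · exact ⟨i, Finset.mem_insert_self _ _, h⟩
    · obtain ⟨j, hj, h⟩ := ih h
      exact ⟨j, Finset.mem_insert_of_mem hj, h⟩

/-- A half-graph of length `n` for `Q` (for the negation of `Q` if `c` is false). -/
def HasLadder (Q : A → C → Prop) (c : Prop) (n : ℕ) (S : Set A) (P : Set C) : Prop :=
  ∃ (a : Fin n → A) (b : Fin n → C), (∀ t, a t ∈ S) ∧ (∀ t, b t ∈ P) ∧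
    ∀ t u, Q (a t) (b u) ↔ (c ↔ t ≤ u)

theorem HasLadder.mono {Q : A → C → Prop} {c : Prop} {n : ℕ} {S S' : Set A} {P P' : Set C}
    (h : HasLadder Q c n S P) (hS : S ⊆ S') (hP : P ⊆ P') : HasLadder Q c n S' P' :=
  let ⟨a, b, ha, hb, hab⟩ := h
  ⟨a, b, fun t => hS (ha t), fun t => hP (hb t), hab⟩

theorem HasLadder.cons {Q : A → C → Prop} {c : Prop} {n : ℕ} {S : Set A} {P : Set C} {a : A} {b : C}
    (ha : a ∈ S) (hb : b ∈ P) (haP : ∀ b ∈ P, Q a b ↔ c)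
    (h : HasLadder Q c n (S ∩ {x | Q x b ↔ ¬ c}) P) : HasLadder Q c (n + 1) S P := by
  obtain ⟨a', b', ha', hb', hab⟩ := h
  refine ⟨Fin.cons a a', Fin.cons b b', ?_, ?_, ?_⟩
  · exact fun t => Fin.cases ha (fun t => (ha' t).1) t
  · exact fun t => Fin.cases hb hb' t
  · intro t u
    refine Fin.cases ?_ (fun t => ?_) t <;> refine Fin.cases ?_ (fun u => ?_) u
    · simpa using haP b hb
    · simpa using haP _ (hb' u)
    · have := (ha' t).2
      simpa using this
    · simpa using hab t u

theorem exists_ladder_of_splitTree (n m : ℕ) : ∃ h : ℕ, ∀ (A C : Type) (Q : A → C → Prop)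
    (S : Set A) (P : Set C), SplitTree Q P h S →
      HasLadder Q True n S P ∨ HasLadder Q False m S P := by
  induction n generalizing m with
  | zero =>
    exact ⟨0, fun A C Q S P _ => Or.inl ⟨Fin.elim0, Fin.elim0, nofun, nofun, nofun⟩⟩
  | succ n ihn =>
    induction m with
    | zero =>
      exact ⟨0, fun A C Q S P _ => Or.inr ⟨Fin.elim0, Fin.elim0, nofun, nofun, nofun⟩⟩
    | succ m ihm =>
      obtain ⟨h₁, H₁⟩ := ihn (m + 1)
      obtain ⟨h₂, H₂⟩ := ihm
      refine ⟨(h₁ + 1) + (h₂ + 1), fun A C Q S P h => ?_⟩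
      obtain ⟨a, ha⟩ := h.nonempty
      have hP : P = (P ∩ {b | Q a b}) ∪ (P ∩ {b | ¬ Q a b}) := by
        ext b; simp only [mem_union, mem_inter_iff, mem_ofPred_eq]; tauto
      rw [hP] at h
      rcases h.of_union with h | h
      · obtain ⟨b, hb, -, h⟩ := h
        rcases H₁ _ _ _ _ _ h with h | h
        · exact Or.inl ((HasLadder.cons ha hb (fun b hb => by simpa using hb.2)
            (h.mono (by simp) subset_rfl)).mono subset_rfl inter_subset_left)
        · exact Or.inr (h.mono inter_subset_left inter_subset_left)
      · obtain ⟨b, hb, h, -⟩ := h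
        rcases H₂ _ _ _ _ _ h with h | h
        · exact Or.inl (h.mono inter_subset_left inter_subset_left)
        · exact Or.inr ((HasLadder.cons ha hb (fun b hb => by simpa using hb.2)
            (h.mono (by simp) subset_rfl)).mono subset_rfl inter_subset_left)

end Trees

section Stability

variable {L : FirstOrder.Language.{u, v}}

theorem IsStable.exists_no_ladder {T : L.Theory} (hT : IsStable L T) {X Y : Type}
    (φ : L.Formula (X ⊕ Y)) :
    ∃ N : ℕ, ∀ (M : Type) [L.Structure M] [Nonempty M], M ⊨ T →
      ∀ (a : Fin N → X → M) (b : Fin N → Y → M),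
        ¬ ∀ i j, φ.Realize (Sum.elim (a i) (b j)) ↔ i ≤ j := by
  obtain ⟨n, m, i, j, φ₀, -, -, h⟩ := exists_finite_variables φ
  by_contra! hc
  refine hT ⟨n, m, φ₀, fun N => ?_⟩
  obtain ⟨M, sM, nM, hM, a, b, hab⟩ := hc N
  refine ⟨M, sM, fun t => a t ∘ i, fun t => b t ∘ j, nM, hM, fun t u => ?_⟩
  rw [← hab t u, h, Sum.elim_comp_map]

/-- In a stable theory the splitting trees for a finite family of formulas are bounded. -/
theorem IsStable.exists_no_splitTree {T : L.Theory} (hT : IsStable L T) {ι X Y : Type} [Finite ι]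
    (φ : ι → L.Formula (X ⊕ Y)) :
    ∃ k : ℕ, ∀ (M : Type) [L.Structure M] [Nonempty M], M ⊨ T →
      ¬ SplitTree (fun (x : X → M) (c : ι × (Y → M)) => (φ c.1).Realize (Sum.elim x c.2))
        univ k univ := by
  classical
  have := Fintype.ofFinite ι
  choose N hN using fun l => hT.exists_no_ladder (φ l)
  choose N' hN' using fun l => hT.exists_no_ladder (φ l).not
  choose K hK using fun l => exists_ladder_of_splitTree (N l) (N' l)
  refine ⟨∑ l, K l + 1, fun M _ _ hM h => ?_⟩
  have hu : (univ : Set (ι × (Y → M))) = ⋃ l ∈ (Finset.univ : Finset ι), {c | c.1 = l} := by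
    ext c; simp
  rw [hu] at h
  obtain ⟨l, -, h⟩ := SplitTree.of_biUnion _ h
  rcases hK l _ _ _ _ _ h with ⟨a, b, -, hb, hab⟩ | ⟨a, b, -, hb, hab⟩
  · refine hN l M hM a (fun t => (b t).2) fun t u => ?_
    have := hab t u
    beta_reduce at this
    rw [show (b u).1 = l from hb u] at this
    simpa using this
  · refine hN' l M hM a (fun t => (b t).2) fun t u => ?_
    have := hab t u
    beta_reduce at this
    rw [show (b u).1 = l from hb u] at this
    rw [Formula.realize_not, this]
    simp

end Stability

section Wide

variable {A C : Type*}

/-- The `i`-th member of a family of sets that are pairwise separated by instances of `Q`. -/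
def sepCell (Q : A → C → Prop) {m : ℕ} (c : Sym2 (Fin m) → C) (ε : Sym2 (Fin m) → Prop)
    (i : Fin m) : Set A :=
  {x | ∀ j, j ≠ i → (Q x (c s(i, j)) ↔ (ε s(i, j) ↔ i < j))}

/-- `S` carries a tree of height `k` in which every node splits into `m` pairwise separated
parts. -/
def Wide (Q : A → C → Prop) (m : ℕ) : ℕ → Set A → Prop
  | 0, S => S.Nonempty
  | k + 1, S => ∃ c ε, ∀ i : Fin m, Wide Q m k (S ∩ sepCell Q c ε i)

variable {Q : A → C → Prop} {m k : ℕ} {S S' : Set A}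

theorem Wide.mono (hS : S ⊆ S') (h : Wide Q m k S) : Wide Q m k S' := by
  induction k generalizing S S' with
  | zero => exact Set.Nonempty.mono hS h
  | succ k ih =>
    obtain ⟨c, ε, h⟩ := h
    exact ⟨c, ε, fun i => ih (inter_subset_inter_left _ hS) (h i)⟩

theorem Wide.nonempty (hm : 0 < m) (h : Wide Q m k S) : S.Nonempty := by
  induction k generalizing S with
  | zero => exact h
  | succ k ih =>
    obtain ⟨c, ε, h⟩ := h
    exact (ih (h ⟨0, hm⟩)).mono inter_subset_left

theorem sepCell_comp {n m : ℕ} (f : Fin n ↪o Fin m) (c : Sym2 (Fin m) → C)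
    (ε : Sym2 (Fin m) → Prop) (i : Fin n) :
    sepCell Q c ε (f i) ⊆ sepCell Q (c ∘ Sym2.map f) (ε ∘ Sym2.map f) i := by
  intro x hx j hj
  have := hx (f j) (by simpa using hj)
  simpa using this

theorem Wide.anti {n m : ℕ} (hnm : n ≤ m) (h : Wide Q m k S) : Wide Q n k S := by
  induction k generalizing S with
  | zero => exact h
  | succ k ih =>
    obtain ⟨c, ε, h⟩ := h
    exact ⟨_, _, fun i => (ih (h (Fin.castLEOrderEmb hnm i))).mono
      (inter_subset_inter_right _ (sepCell_comp (Fin.castLEOrderEmb hnm) c ε i))⟩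

theorem Wide.of_union (h : Wide Q (m + m) k (S ∪ S')) : Wide Q m k S ∨ Wide Q m k S' := by
  classical
  induction k generalizing S S' with
  | zero => exact union_nonempty.1 h
  | succ k ih =>
    obtain ⟨c, ε, h⟩ := h
    have h' (i) := ih (union_inter_distrib_right _ _ _ ▸ h i)
    have key (R : Set A) (hR : m ≤ (Finset.univ.filter
        fun i => Wide Q m k (R ∩ sepCell Q c ε i)).card) : Wide Q m (k + 1) R := by
      let f := Finset.orderEmbOfCardLe _ hR
      refine ⟨_, _, fun i => Wide.mono (inter_subset_inter_right _ (sepCell_comp f c ε i)) ?_⟩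
      have := Finset.orderEmbOfCardLe_mem _ hR i
      exact (Finset.mem_filter.1 this).2
    by_contra! hc
    have h1 := lt_of_not_ge (mt (key S) hc.1)
    have h2 := lt_of_not_ge (mt (key S') hc.2)
    have h3 : (Finset.univ : Finset (Fin (m + m))) ⊆
        (Finset.univ.filter fun i => Wide Q m k (S ∩ sepCell Q c ε i)) ∪
        (Finset.univ.filter fun i => Wide Q m k (S' ∩ sepCell Q c ε i)) := by
      intro i _
      simpa using h' i
    have h4 := (Finset.card_le_card h3).trans (Finset.card_union_le _ _)
    rw [Finset.card_univ, Fintype.card_fin] at h4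
    omega

theorem Wide.of_separated [Nonempty C] {P : Fin m → Set A} (hP : ∀ i, Wide Q m k (S ∩ P i))
    (hsep : ∀ i j, i ≠ j → ∃ (c : C) (p q : Prop), ¬ (p ↔ q) ∧ (∀ x ∈ P i, Q x c ↔ p) ∧
      ∀ x ∈ P j, Q x c ↔ q) : Wide Q m (k + 1) S := by
  have hsep' (i j : Fin m) : ∃ (c : C) (ε : Prop), i < j →
      (∀ x ∈ P i, Q x c ↔ ε) ∧ ∀ x ∈ P j, Q x c ↔ ¬ ε := by
    by_cases h : i < j
    · obtain ⟨c, p, q, hpq, h1, h2⟩ := hsep i j h.ne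
      refine ⟨c, p, fun _ => ⟨h1, fun x hx => ?_⟩⟩
      rw [h2 x hx]
      tauto
    · exact ⟨Classical.arbitrary C, True, fun h' => absurd h' h⟩
  choose c ε h using hsep'
  refine ⟨fun z => c z.inf z.sup, fun z => ε z.inf z.sup, fun i =>
    (hP i).mono (inter_subset_inter_right _ fun x hx j hj => ?_)⟩
  rcases lt_or_gt_of_ne hj with hij | hij
  · simpa [hij.le, hij.not_gt] using (h j i hij).2 x hx
  · simpa [hij.le, hij] using (h i j hij).1 x hx

theorem Wide.splitTree (h : Wide Q 2 k S) : SplitTree Q univ k S := by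
  induction k generalizing S with
  | zero => exact h
  | succ k ih =>
    obtain ⟨c, ε, h⟩ := h
    refine ⟨c s(0, 1), mem_univ _, ?_⟩
    have h0 : sepCell Q c ε 0 ⊆ {x | Q x (c s(0, 1)) ↔ ε s(0, 1)} := fun x hx => by
      simpa using hx 1 (by simp)
    have h1 : sepCell Q c ε 1 ⊆ {x | Q x (c s(0, 1)) ↔ ¬ ε s(0, 1)} := fun x hx => by
      simpa [Sym2.eq_swap] using hx 0 (by simp)
    have h0' := ih ((h 0).mono (inter_subset_inter_right _ h0))
    have h1' := ih ((h 1).mono (inter_subset_inter_right _ h1))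
    by_cases hε : ε s(0, 1) <;> simp only [hε, iff_true, iff_false, not_true_eq_false, not_false_eq_true] at h0' h1'
    · exact ⟨h0', h1'⟩
    · exact ⟨h1', h0'⟩

end Wide

section Large

variable {A B ι : Type*}

/-- The set `D` is large with respect to the family `𝓕`: it meets every member of `𝓕` in a set
of maximal possible width. -/
def Large {A C : Type*} (Q : A → C → Prop) (k : ℕ) (𝓕 : Set (Set A)) (D : Set A) : Prop :=
  ∀ S ∈ 𝓕, ∀ m, Wide Q m k (S ∩ D)

section

variable {C : Type*} {Q : A → C → Prop} {k : ℕ} {𝓕 : Set (Set A)}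

theorem Large.mono {D D' : Set A} (h : Large Q k 𝓕 D) (hD : D ⊆ D') : Large Q k 𝓕 D' :=
  fun S hS m => (h S hS m).mono (inter_subset_inter_right _ hD)

theorem Large.of_union (h𝓕 : ∀ S ∈ 𝓕, ∀ S' ∈ 𝓕, S ∩ S' ∈ 𝓕) {D D' : Set A}
    (h : Large Q k 𝓕 (D ∪ D')) : Large Q k 𝓕 D ∨ Large Q k 𝓕 D' := by
  by_contra! hc
  simp only [Large, not_forall] at hc
  obtain ⟨⟨S, hS, m, h1⟩, S', hS', m', h2⟩ := hc
  have := h _ (h𝓕 S hS S' hS') (max m m' + max m m')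
  rw [inter_union_distrib_left] at this
  rcases this.of_union with h | h
  · exact h1 ((h.anti (le_max_left _ _)).mono (inter_subset_inter_left _ inter_subset_left))
  · exact h2 ((h.anti (le_max_right _ _)).mono (inter_subset_inter_left _ inter_subset_right))

theorem Large.inter_nonempty {D S : Set A} (h : Large Q k 𝓕 D) (hS : S ∈ 𝓕) : (S ∩ D).Nonempty :=
  (h S hS 1).nonempty one_pos

theorem Large.of_biUnion (hne : 𝓕.Nonempty) (h𝓕 : ∀ S ∈ 𝓕, ∀ S' ∈ 𝓕, S ∩ S' ∈ 𝓕) {κ : Type*}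
    (F : Finset κ) {D : κ → Set A} (h : Large Q k 𝓕 (⋃ i ∈ F, D i)) :
    ∃ i ∈ F, Large Q k 𝓕 (D i) := by
  classical
  induction F using Finset.induction_on with
  | empty =>
    obtain ⟨S, hS⟩ := hne
    simpa using h.inter_nonempty hS
  | insert i F hi ih =>
    rw [Finset.set_biUnion_insert] at h
    rcases h.of_union h𝓕 with h | h
    · exact ⟨i, Finset.mem_insert_self _ _, h⟩
    · obtain ⟨j, hj, h⟩ := ih h
      exact ⟨j, Finset.mem_insert_of_mem hj, h⟩

theorem Large.of_iUnion (hne : 𝓕.Nonempty) (h𝓕 : ∀ S ∈ 𝓕, ∀ S' ∈ 𝓕, S ∩ S' ∈ 𝓕) {κ : Type*}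
    [Finite κ] {D : κ → Set A} (h : Large Q k 𝓕 (⋃ i, D i)) : ∃ i, Large Q k 𝓕 (D i) := by
  have := Fintype.ofFinite κ
  obtain ⟨i, -, hi⟩ := Large.of_biUnion hne h𝓕 (Finset.univ : Finset κ) (D := D) (by simpa using h)
  exact ⟨i, hi⟩

end

/-- The points at which two parameters are distinguished by some instance of `Q`. -/
def diffSet (Q : A → ι × B → Prop) (b b' : B) : Set A :=
  {x | ∃ l, ¬ (Q x (l, b) ↔ Q x (l, b'))}

theorem diffSet_self (Q : A → ι × B → Prop) (b : B) : diffSet Q b b = ∅ := by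
  simp [diffSet]

theorem diffSet_comm (Q : A → ι × B → Prop) (b b' : B) : diffSet Q b b' = diffSet Q b' b := by
  ext x
  simp only [diffSet, mem_ofPred_eq]
  exact exists_congr fun l => by tauto

theorem diffSet_subset (Q : A → ι × B → Prop) (b b' b'' : B) :
    diffSet Q b b'' ⊆ diffSet Q b b' ∪ diffSet Q b' b'' := by
  rintro x ⟨l, hl⟩
  by_cases h : Q x (l, b) ↔ Q x (l, b')
  · exact Or.inr ⟨l, by tauto⟩
  · exact Or.inl ⟨l, h⟩

/-- The points with prescribed pattern over the parameters `e`. -/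
def patternCell {N : ℕ} (Q : A → ι × B → Prop) (e : Fin N → B) (s : Fin N → ι → Prop) : Set A :=
  {x | ∀ i l, Q x (l, e i) ↔ s i l}

variable {Q : A → ι × B → Prop} {k : ℕ} {𝓕 : Set (Set A)}

theorem exists_large_patternCell [Finite ι] (hne : 𝓕.Nonempty)
    (h𝓕 : ∀ S ∈ 𝓕, ∀ S' ∈ 𝓕, S ∩ S' ∈ 𝓕) {N : ℕ} (e : Fin N → B) {D : Set A}
    (hD : Large Q k 𝓕 D) : ∃ s, Large Q k 𝓕 (D ∩ patternCell Q e s) := by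
  refine Large.of_iUnion hne h𝓕 (hD.mono fun x hx => ?_)
  exact mem_iUnion.2 ⟨fun i l => Q x (l, e i), hx, fun i l => Iff.rfl⟩

theorem card_le_of_pairwise_large [Finite ι] [Nonempty (ι × B)] (hne : 𝓕.Nonempty)
    (h𝓕 : ∀ S ∈ 𝓕, ∀ S' ∈ 𝓕, S ∩ S' ∈ 𝓕) {S₀ : Set A} (hS₀ : S₀ ∈ 𝓕) {m₀ : ℕ}
    (hm₀ : ¬ Wide Q m₀ (k + 1) S₀) {N : ℕ} (e : Fin N → B)
    (he : ∀ i j, i ≠ j → Large Q k 𝓕 (diffSet Q (e i) (e j))) :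
    N ≤ Nat.card (Fin m₀ → ι → Prop) := by
  classical
  let G : Set (Fin N → ι → Prop) := {s | Large Q k 𝓕 (patternCell Q e s)}
  have hG : Nat.card G ≤ m₀ := by
    by_contra! hlt
    have := Fintype.ofFinite G
    rw [Nat.card_eq_fintype_card] at hlt
    obtain ⟨f⟩ : Nonempty (Fin m₀ ↪ G) := by
      rw [Function.Embedding.nonempty_iff_card_le, Fintype.card_fin]
      exact hlt.le
    refine hm₀ (Wide.of_separated (P := fun i => patternCell Q e (f i)) (fun i => (f i).2 S₀ hS₀ m₀)
      fun i j hij => ?_)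
    have hne : (f i : Fin N → ι → Prop) ≠ f j := fun h => hij (f.injective (Subtype.ext h))
    obtain ⟨t, ht⟩ := Function.ne_iff.1 hne
    obtain ⟨l, hl⟩ := Function.ne_iff.1 ht
    exact ⟨(l, e t), _, _, fun h => hl (propext h), fun x hx => hx t l, fun x hx => hx t l⟩
  have hinj : Function.Injective fun (i : Fin N) (s : G) => s.1 i := by
    intro i j hij
    by_contra hne'
    obtain ⟨s, hs⟩ := exists_large_patternCell hne h𝓕 e (he i j hne')
    have hsG : s ∈ G := hs.mono inter_subset_right
    have hs' := congrFun hij ⟨s, hsG⟩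
    obtain ⟨S, hS⟩ := hne
    obtain ⟨x, -, ⟨l, hl⟩, hx⟩ := hs.inter_nonempty hS
    refine hl ?_
    rw [hx i l, hx j l]
    exact Iff.of_eq (congrFun hs' l)
  have h1 := Nat.card_le_card_of_injective _ hinj
  rw [Nat.card_fin] at h1
  refine h1.trans ?_
  rw [Nat.card_fun, Nat.card_fun (α := Fin m₀), Nat.card_fin]
  exact Nat.pow_le_pow_right Nat.card_pos hG

end Large

section GenericDefinitions

variable {L : FirstOrder.Language.{u, v}} {X Y ι : Type}

/-- The relation between tuples and (labelled) parameter tuples given by a family of formulas. -/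
abbrev instRel (φ : ι → L.Formula (X ⊕ Y)) (M : Type) [L.Structure M] :
    (X → M) → ι × (Y → M) → Prop :=
  fun x c => (φ c.1).Realize (Sum.elim x c.2)

theorem UniformFO.wide [Finite ι] (φ : ι → L.Formula (X ⊕ Y)) (m k : ℕ) {Z : Type}
    {Ψ : ∀ (M : Type) [L.Structure M], (Z ⊕ X → M) → Prop} (hΨ : UniformFO Ψ) :
    UniformFO (L := L) fun M _ (z : Z → M) =>
      Wide (instRel φ M) m k {x | Ψ M (Sum.elim z x)} := by
  induction k generalizing Z with
  | zero => exact hΨ.exists_tuple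
  | succ k ih =>
    let Ψ' (lam : Sym2 (Fin m) → ι) (ε : Sym2 (Fin m) → Prop) (i : Fin m) (M : Type)
        [L.Structure M] (w : (Z ⊕ Sym2 (Fin m) × Y) ⊕ X → M) : Prop :=
      Ψ M (w ∘ Sum.map Sum.inl id) ∧ ∀ j, j ≠ i →
        ((φ (lam s(i, j))).Realize (w ∘ Sum.elim Sum.inr fun y => Sum.inl (Sum.inr (s(i, j), y))) ↔
          (ε s(i, j) ↔ i < j))
    have hΨ' (lam ε i) : UniformFO (Ψ' lam ε i) :=
      (hΨ.relabel _).and <| UniformFO.forall_finite fun j =>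
        (UniformFO.const _).imp <| ((UniformFO.of_formula _).relabel _).iff (UniformFO.const _)
    have key : UniformFO (L := L) fun M _ (z : Z → M) =>
        ∃ lam ε, ∃ w : Sym2 (Fin m) × Y → M, ∀ i, Wide (instRel φ M) m k
          {x | Ψ' lam ε i M (Sum.elim (Sum.elim z w) x)} :=
      UniformFO.exists_finite fun lam => UniformFO.exists_finite fun ε =>
        UniformFO.exists_tuple (UniformFO.forall_finite fun i => ih (hΨ' lam ε i))
    refine key.congr fun M _ _ z => ?_
    have cell (c : Sym2 (Fin m) → ι × (Y → M)) (ε i) :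
        {x | Ψ' (fun t => (c t).1) ε i M (Sum.elim (Sum.elim z fun t => (c t.1).2 t.2) x)} =
        {x | Ψ M (Sum.elim z x)} ∩ sepCell (instRel φ M) c ε i := by
      ext x
      simp only [Ψ', sepCell, mem_inter_iff, mem_ofPred_eq, Sum.elim_comp_map, Sum.comp_elim,
        Sum.elim_comp_inl, Function.comp_id]
      rfl
    constructor
    · rintro ⟨lam, ε, w, h⟩
      exact ⟨fun t => (lam t, fun y => w (t, y)), ε, fun i => by rw [← cell]; exact h i⟩
    · rintro ⟨c, ε, h⟩
      exact ⟨fun t => (c t).1, ε, fun t => (c t.1).2 t.2, fun i => by rw [cell]; exact h i⟩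

/-- The sets defined by the members of `p`. -/
def definedSets (p : Set (L.Formula X)) (M : Type) [L.Structure M] : Set (Set (X → M)) :=
  (fun θ : L.Formula X => {x : X → M | θ.Realize x}) '' p

theorem definedSets_inter {p : Set (L.Formula X)} (hp : ∀ θ ∈ p, ∀ θ' ∈ p, θ ⊓ θ' ∈ p) (M : Type)
    [L.Structure M] : ∀ S ∈ definedSets p M, ∀ S' ∈ definedSets p M, S ∩ S' ∈ definedSets p M := by
  rintro _ ⟨θ, hθ, rfl⟩ _ ⟨θ', hθ', rfl⟩
  refine ⟨_, hp θ hθ θ' hθ', ?_⟩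
  ext x
  simp

/-- The formulas `d` define, over the empty set, a generic type extending `p`: any finitely many
of the conditions `φ_l(x, b) ↔ d_l(b)` are consistent with `p`, in every model of `T`. -/
def IsGenericDef (T : L.Theory) (p : Set (L.Formula X)) (φ : ι → L.Formula (X ⊕ Y))
    (d : ι → L.Formula Y) : Prop :=
  ∀ (M : Type) [L.Structure M] [Nonempty M], M ⊨ T → ∀ θ ∈ p, ∀ (r : ℕ) (b : Fin r → Y → M),
    ∃ x : X → M, θ.Realize x ∧
      ∀ j l, (φ l).Realize (Sum.elim x (b j)) ↔ (d l).Realize (b j)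

variable {T : L.Theory} {p : Set (L.Formula X)}

/-- The maximal height of infinitely branching trees inside all members of `p`. -/
theorem exists_maximal_height [Finite ι] (hT : T.IsComplete) (hst : IsStable L T)
    (hsat : ∀ θ ∈ p, ∀ (M : Type) [L.Structure M] [Nonempty M], M ⊨ T → ∃ x : X → M, θ.Realize x)
    (hne : p.Nonempty) (M : Type) [L.Structure M] [Nonempty M] (hM : M ⊨ T)
    (φ : ι → L.Formula (X ⊕ Y)) :
    ∃ k, (∀ θ ∈ p, ∀ (m : ℕ) (M : Type) [L.Structure M] [Nonempty M], M ⊨ T →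
        Wide (instRel φ M) m k {x | θ.Realize x}) ∧
      ∃ θ ∈ p, ∃ m : ℕ, ∀ (M : Type) [L.Structure M] [Nonempty M], M ⊨ T →
        ¬ Wide (instRel φ M) m (k + 1) {x | θ.Realize x} := by
  classical
  have hU (θ : L.Formula X) (m k : ℕ) : UniformFO (L := L) fun M _ (_ : Empty → M) =>
      Wide (instRel φ M) m k {x | θ.Realize x} :=
    (UniformFO.wide φ m k ((UniformFO.of_formula θ).relabel (Sum.inr : X → Empty ⊕ X))).congr
      fun M _ _ v => by simp
  have hex : ∃ k, ∃ θ ∈ p, ∃ m, ¬ Wide (instRel φ M) m k {x | θ.Realize x} := by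
    obtain ⟨k, hk⟩ := hst.exists_no_splitTree φ
    obtain ⟨θ, hθ⟩ := hne
    exact ⟨k, θ, hθ, 2, fun h => hk M hM (h.splitTree.mono (subset_univ _))⟩
  obtain ⟨θ, hθ, m, h⟩ := Nat.find_spec hex
  have hpos : Nat.find hex ≠ 0 := by
    intro h0
    rw [h0] at h
    exact h (hsat θ hθ M hM)
  obtain ⟨k, hk⟩ := Nat.exists_eq_succ_of_ne_zero hpos
  refine ⟨k, fun θ' hθ' m' N _ _ hN => ?_, θ, hθ, m, fun N _ _ hN => ?_⟩
  · have := Nat.find_min hex (m := k) (by omega)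
    push Not at this
    exact (hU θ' m' k).transfer hT M N hM hN (this θ' hθ' m')
  · rw [hk] at h
    exact (hU θ m (k + 1)).not.transfer hT M N hM hN h

/-- A maximal family of pairwise inequivalent parameters. -/
theorem exists_maximal_pairwise_large [Finite ι] [Nonempty ι]
    (hinf : ∀ θ ∈ p, ∀ θ' ∈ p, θ ⊓ θ' ∈ p)
    (M : Type) [L.Structure M] [Nonempty M] (hM : M ⊨ T)
    {φ : ι → L.Formula (X ⊕ Y)} {k : ℕ}
    (hk : ∃ θ ∈ p, ∃ m : ℕ, ∀ (M : Type) [L.Structure M] [Nonempty M], M ⊨ T →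
        ¬ Wide (instRel φ M) m (k + 1) {x | θ.Realize x}) :
    ∃ N, (∃ (M : Type) (_ : L.Structure M) (_ : Nonempty M) (_ : M ⊨ T) (e : Fin N → Y → M),
        ∀ i j, i ≠ j → Large (instRel φ M) k (definedSets p M) (diffSet (instRel φ M) (e i) (e j))) ∧
      ∀ (M : Type) [L.Structure M] [Nonempty M], M ⊨ T → ∀ e : Fin (N + 1) → Y → M,
        ¬ ∀ i j, i ≠ j →
          Large (instRel φ M) k (definedSets p M) (diffSet (instRel φ M) (e i) (e j)) := by
  classical
  obtain ⟨θ, hθ, m, hm⟩ := hk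
  let R (N : ℕ) : Prop := ∃ (M : Type) (_ : L.Structure M) (_ : Nonempty M) (_ : M ⊨ T)
    (e : Fin N → Y → M), ∀ i j, i ≠ j →
      Large (instRel φ M) k (definedSets p M) (diffSet (instRel φ M) (e i) (e j))
  have hR0 : R 0 := ⟨M, inferInstance, inferInstance, hM, Fin.elim0, nofun⟩
  have hRb (N : ℕ) (hN : R N) : N ≤ Nat.card (Fin m → ι → Prop) := by
    obtain ⟨M, _, _, hM, e, he⟩ := hN
    exact card_le_of_pairwise_large ⟨_, mem_image_of_mem _ hθ⟩ (definedSets_inter hinf M)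
      (mem_image_of_mem _ hθ) (hm M hM) e he
  have hex : ∃ N, ¬ R N := ⟨_, fun h => absurd (hRb _ h) (Nat.not_succ_le_self _)⟩
  have hpos : Nat.find hex ≠ 0 := fun h0 => by
    have := Nat.find_spec hex
    rw [h0] at this
    exact this hR0
  obtain ⟨N, hN⟩ := Nat.exists_eq_succ_of_ne_zero hpos
  refine ⟨N, not_not.1 (Nat.find_min hex (m := N) (by omega)), fun M _ _ hM e he => ?_⟩
  have := Nat.find_spec hex
  rw [hN] at this
  exact this ⟨M, inferInstance, inferInstance, hM, e, he⟩

end GenericDefinitions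

section AbstractEquivalence

variable {A B ι : Type*} {Q : A → ι × B → Prop} {k : ℕ} {𝓕 : Set (Set A)}

theorem not_large_diffSet_trans (h𝓕 : ∀ S ∈ 𝓕, ∀ S' ∈ 𝓕, S ∩ S' ∈ 𝓕) {b b' b'' : B}
    (h : ¬ Large Q k 𝓕 (diffSet Q b b')) (h' : ¬ Large Q k 𝓕 (diffSet Q b' b'')) :
    ¬ Large Q k 𝓕 (diffSet Q b b'') := fun hc =>
  ((hc.mono (diffSet_subset Q b b' b'')).of_union h𝓕).elim h h'

theorem not_large_diffSet_self (hne : 𝓕.Nonempty) (b : B) : ¬ Large Q k 𝓕 (diffSet Q b b) := by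
  intro h
  obtain ⟨S, hS⟩ := hne
  simpa [diffSet_self] using h.inter_nonempty hS

theorem pairwise_cons {N : ℕ} {r : B → B → Prop} (hr : ∀ b b', r b b' → r b' b) {e : Fin N → B}
    (he : ∀ i j, i ≠ j → r (e i) (e j)) {b : B} (hb : ∀ i, r b (e i)) :
    ∀ i j, i ≠ j → r ((Fin.cons b e : Fin (N + 1) → B) i) ((Fin.cons b e : Fin (N + 1) → B) j) := by
  intro i j
  refine Fin.cases ?_ (fun i => ?_) i <;> refine Fin.cases ?_ (fun j => ?_) j
  · simp
  · exact fun _ => by simpa using hb j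
  · exact fun _ => by simpa using hr _ _ (hb i)
  · intro h
    simpa using he i j (by simpa using h)

theorem exists_not_large_diffSet {N : ℕ} {e : Fin N → B}
    (he : ∀ i j, i ≠ j → Large Q k 𝓕 (diffSet Q (e i) (e j)))
    (hmax : ∀ e : Fin (N + 1) → B, ¬ ∀ i j, i ≠ j → Large Q k 𝓕 (diffSet Q (e i) (e j))) (b : B) :
    ∃ i, ¬ Large Q k 𝓕 (diffSet Q b (e i)) := by
  by_contra! h
  exact hmax _ (pairwise_cons (r := fun b b' => Large Q k 𝓕 (diffSet Q b b'))
    (fun b b' h => by rwa [diffSet_comm]) he h)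

theorem exists_pairwise_wide (h𝓕 : ∀ S ∈ 𝓕, ∀ S' ∈ 𝓕, S ∩ S' ∈ 𝓕) {N : ℕ} {e : Fin N → B}
    (he : ∀ i j, i ≠ j → Large Q k 𝓕 (diffSet Q (e i) (e j)))
    (hmax : ∀ e : Fin (N + 1) → B, ¬ ∀ i j, i ≠ j → Large Q k 𝓕 (diffSet Q (e i) (e j)))
    {S : Set A} (hS : S ∈ 𝓕) {m : ℕ} {b b' : B} (hb : ¬ Large Q k 𝓕 (diffSet Q b b'))
    (hw : Wide Q m k (S ∩ diffSet Q b b')) :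
    ∃ f : Fin (N + 1) → B, ∀ i j, i ≠ j → Wide Q m k (S ∩ diffSet Q (f i) (f j)) := by
  classical
  obtain ⟨i, hi⟩ := exists_not_large_diffSet he hmax b
  have hi' : ¬ Large Q k 𝓕 (diffSet Q b' (e i)) :=
    not_large_diffSet_trans h𝓕 (by rwa [diffSet_comm]) hi
  have other {c : B} (hc : ¬ Large Q k 𝓕 (diffSet Q c (e i))) {j : Fin N} (hj : j ≠ i) :
      Large Q k 𝓕 (diffSet Q c (e j)) := by
    by_contra hcj
    exact not_large_diffSet_trans h𝓕 (by rwa [diffSet_comm]) hcj (he i j hj.symm)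
  have symm (b b' : B) (h : Wide Q m k (S ∩ diffSet Q b b')) : Wide Q m k (S ∩ diffSet Q b' b) := by
    rwa [diffSet_comm]
  refine ⟨Fin.cons b' (Function.update e i b),
    pairwise_cons (r := fun b b' => Wide Q m k (S ∩ diffSet Q b b')) symm ?_ ?_⟩
  · intro j j' hjj'
    by_cases hj : j = i
    · subst hj
      simpa [hjj'.symm] using other hi hjj'.symm S hS m
    · by_cases hj' : j' = i
      · subst hj'
        simpa [hj] using symm _ _ (other hi hj S hS m)
      · simpa [hj, hj'] using he j j' hjj' S hS m
  · intro j
    by_cases hj : j = i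
    · subst hj
      simpa using symm _ _ hw
    · simpa [hj] using other hi' hj S hS m

end AbstractEquivalence

section GenericDefinitions

variable {L : FirstOrder.Language.{u, v}} {X Y ι : Type} {T : L.Theory} {p : Set (L.Formula X)}

theorem UniformFO.wide_inter_diffSet [Finite ι] (φ : ι → L.Formula (X ⊕ Y)) (θ : L.Formula X)
    (m k : ℕ) : UniformFO (L := L) fun M _ (z : Y ⊕ Y → M) =>
      Wide (instRel φ M) m k
        ({x | θ.Realize x} ∩ diffSet (instRel φ M) (z ∘ Sum.inl) (z ∘ Sum.inr)) := by
  have h : UniformFO (L := L) fun M _ (w : (Y ⊕ Y) ⊕ X → M) => θ.Realize (w ∘ Sum.inr) ∧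
      ∃ l, ¬ ((φ l).Realize (w ∘ Sum.elim Sum.inr (Sum.inl ∘ Sum.inl)) ↔
        (φ l).Realize (w ∘ Sum.elim Sum.inr (Sum.inl ∘ Sum.inr))) :=
    ((UniformFO.of_formula θ).relabel _).and <| UniformFO.exists_finite fun l =>
      (((UniformFO.of_formula (φ l)).relabel _).iff ((UniformFO.of_formula (φ l)).relabel _)).not
  refine (UniformFO.wide φ m k h).congr fun M _ _ v => ?_
  simp only [Sum.comp_elim, Sum.elim_comp_inr, ← Function.comp_assoc, Sum.elim_comp_inl]
  rfl

/-- At a maximal family, largeness of difference sets is detected by a single member of the type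
and a single width. -/
theorem exists_uniform_width [Countable L.Symbols] [Finite ι]
    (hne : p.Nonempty) (hinf : ∀ θ ∈ p, ∀ θ' ∈ p, θ ⊓ θ' ∈ p)
    {φ : ι → L.Formula (X ⊕ Y)} {k N : ℕ}
    (hmax : ∀ (M : Type) [L.Structure M] [Nonempty M], M ⊨ T → ∀ e : Fin (N + 1) → Y → M,
      ¬ ∀ i j, i ≠ j →
        Large (instRel φ M) k (definedSets p M) (diffSet (instRel φ M) (e i) (e j)))
    (M : Type) [L.Structure M] [Nonempty M] (hM : M ⊨ T) {e : Fin N → Y → M}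
    (he : ∀ i j, i ≠ j →
      Large (instRel φ M) k (definedSets p M) (diffSet (instRel φ M) (e i) (e j))) :
    ∃ θ ∈ p, ∃ m, ∀ b b' : Y → M,
      Large (instRel φ M) k (definedSets p M) (diffSet (instRel φ M) b b') ↔
        Wide (instRel φ M) m k ({x | θ.Realize x} ∩ diffSet (instRel φ M) b b') := by
  classical
  by_contra! hc
  have hfam (θ : L.Formula X) (hθ : θ ∈ p) (m : ℕ) : ∃ f : Fin (N + 1) → Y → M, ∀ i j, i ≠ j →
      Wide (instRel φ M) m k ({x | θ.Realize x} ∩ diffSet (instRel φ M) (f i) (f j)) := by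
    obtain ⟨b, b', ⟨h1, h2⟩ | ⟨h1, h2⟩⟩ := hc θ hθ m
    · exact absurd (h1 _ (mem_image_of_mem _ hθ) m) h2
    · exact exists_pairwise_wide (definedSets_inter hinf M) he (hmax M hM)
        (mem_image_of_mem _ hθ) h1 h2
  choose ψ hψ using fun (θ : L.Formula X) (m : ℕ) => UniformFO.wide_inter_diffSet φ θ m k
  let vars (i j : Fin (N + 1)) : Y ⊕ Y → Fin (N + 1) × Y :=
    Sum.elim (fun y => (i, y)) fun y => (j, y)
  have hψ' (θ m) (K : Type) [L.Structure K] [Nonempty K] (v : Fin (N + 1) × Y → K) (i j) :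
      ((ψ θ m).relabel (vars i j)).Realize v ↔ Wide (instRel φ K) m k ({x | θ.Realize x} ∩
        diffSet (instRel φ K) (fun y => v (i, y)) fun y => v (j, y)) := by
    rw [Formula.realize_relabel, hψ]
    rfl
  let Φ : Set (L.Formula (Fin (N + 1) × Y)) :=
    {χ | ∃ θ ∈ p, ∃ m i j, i ≠ j ∧ χ = (ψ θ m).relabel (vars i j)}
  have hfin (Φ₀ : Finset (L.Formula (Fin (N + 1) × Y))) (hΦ₀ : (Φ₀ : Set _) ⊆ Φ) :
      ∃ θ ∈ p, ∃ m, ∀ f : Fin (N + 1) → Y → M, (∀ i j, i ≠ j → Wide (instRel φ M) m k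
        ({x | θ.Realize x} ∩ diffSet (instRel φ M) (f i) (f j))) →
        ∀ χ ∈ Φ₀, χ.Realize fun t => f t.1 t.2 := by
    induction Φ₀ using Finset.induction_on with
    | empty =>
      obtain ⟨θ, hθ⟩ := hne
      exact ⟨θ, hθ, 0, by simp⟩
    | insert χ Φ₀ _ ih =>
      rw [Finset.coe_insert, insert_subset_iff] at hΦ₀
      obtain ⟨θ, hθ, m, h⟩ := ih hΦ₀.2
      obtain ⟨θ', hθ', m', i, j, hij, rfl⟩ := hΦ₀.1
      refine ⟨θ ⊓ θ', hinf _ hθ _ hθ', max m m', fun f hf => ?_⟩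
      rw [Finset.forall_mem_insert]
      refine ⟨(hψ' _ _ M _ i j).2 (((hf i j hij).anti (le_max_right _ _)).mono
        (inter_subset_inter_left _ ?_)), h f fun i j hij =>
          ((hf i j hij).anti (le_max_left _ _)).mono (inter_subset_inter_left _ ?_)⟩
      · exact fun x hx => (Formula.realize_inf.1 hx).2
      · exact fun x hx => (Formula.realize_inf.1 hx).1
  obtain ⟨K, _, _, hK, v, hv⟩ := exists_realization T Φ fun Φ₀ hΦ₀ => by
    obtain ⟨θ, hθ, m, h⟩ := hfin Φ₀ hΦ₀
    obtain ⟨f, hf⟩ := hfam θ hθ m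
    exact ⟨M, inferInstance, inferInstance, hM, _, h f hf⟩
  refine hmax K hK (fun i y => v (i, y)) fun i j hij => ?_
  rintro _ ⟨θ, hθ, rfl⟩ m
  exact (hψ' θ m K v i j).1 (hv _ ⟨θ, hθ, m, i, j, hij, rfl⟩)

end GenericDefinitions

section FiniteEquivalence

variable {L : FirstOrder.Language.{u, v}} {X Y ι : Type} {T : L.Theory} {p : Set (L.Formula X)}

theorem exists_finite_variables_diag (φ : L.Formula (Y ⊕ Y)) :
    ∃ (n : ℕ) (i : Fin n → Y) (φ₀ : L.Formula (Fin n ⊕ Fin n)), Function.Injective i ∧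
      ∀ (M : Type) [L.Structure M] (v : Y ⊕ Y → M),
        φ.Realize v ↔ φ₀.Realize (v ∘ Sum.map i i) := by
  classical
  obtain ⟨n, m, i, j, φ₀, -, -, h⟩ := exists_finite_variables φ
  let s : Finset Y := Finset.univ.image i ∪ Finset.univ.image j
  let i' (t : Fin n) : Fin s.card := s.equivFin ⟨i t, by simp [s]⟩
  let j' (t : Fin m) : Fin s.card := s.equivFin ⟨j t, by simp [s]⟩
  refine ⟨s.card, fun t => s.equivFin.symm t, φ₀.relabel (Sum.map i' j'),
    Subtype.val_injective.comp (Equiv.injective _), fun M _ v => ?_⟩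
  rw [h, Formula.realize_relabel, Function.comp_assoc, Sum.map_comp_map]
  have hi : (fun t => (s.equivFin.symm t : Y)) ∘ i' = i := by ext t; simp [i']
  have hj : (fun t => (s.equivFin.symm t : Y)) ∘ j' = j := by ext t; simp [j']
  rw [hi, hj]

theorem AclEqDcl.exists_formulas (hacl : AclEqDcl L T) (hT : T.IsComplete)
    {E : ∀ (M : Type) [L.Structure M], (Y → M) → (Y → M) → Prop}
    (hE : UniformFO (L := L) fun M _ (z : Y ⊕ Y → M) => E M (z ∘ Sum.inl) (z ∘ Sum.inr))
    (M₀ : Type) [L.Structure M₀] [Nonempty M₀] (hM₀ : M₀ ⊨ T) (heq : Equivalence (E M₀))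
    {N : ℕ} {e : Fin N → Y → M₀} (he : ∀ b, ∃ i, E M₀ b (e i)) :
    ∃ (l : ℕ) (χ : Fin l → L.Formula Y), ∀ (M : Type) [L.Structure M] [Nonempty M], M ⊨ T →
      ∀ b b' : Y → M, E M b b' ↔ ∀ t, ((χ t).Realize b ↔ (χ t).Realize b') := by
  have hrefl : UniformFO (L := L) fun M _ (_ : Empty → M) => ∀ b : Y → M, E M b b :=
    (UniformFO.forall_tuple (hE.relabel (Sum.elim Sum.inr Sum.inr : Y ⊕ Y → Empty ⊕ Y)))
  have hsymm : UniformFO (L := L) fun M _ (_ : Empty → M) =>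
      ∀ w : Y ⊕ Y → M, E M (w ∘ Sum.inl) (w ∘ Sum.inr) → E M (w ∘ Sum.inr) (w ∘ Sum.inl) :=
    (UniformFO.forall_tuple (((hE.imp (hE.relabel Sum.swap)).relabel
      (Sum.inr : Y ⊕ Y → Empty ⊕ (Y ⊕ Y)))))
  have htrans : UniformFO (L := L) fun M _ (_ : Empty → M) =>
      ∀ w : Fin 3 × Y → M, E M (fun y => w (0, y)) (fun y => w (1, y)) →
        E M (fun y => w (1, y)) (fun y => w (2, y)) → E M (fun y => w (0, y)) (fun y => w (2, y)) := by
    have hpair (i j : Fin 3) := hE.relabel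
      (Sum.elim (fun y => Sum.inr (i, y)) (fun y => Sum.inr (j, y)) : Y ⊕ Y → Empty ⊕ (Fin 3 × Y))
    exact UniformFO.forall_tuple ((hpair 0 1).imp ((hpair 1 2).imp (hpair 0 2)))
  have hreps : UniformFO (L := L) fun M _ (_ : Empty → M) =>
      ∃ w : Fin N × Y → M, ∀ b : Y → M, ∃ i, E M b fun y => w (i, y) := by
    have hpair (i : Fin N) := hE.relabel
      (Sum.elim Sum.inr (fun y => Sum.inl (Sum.inr (i, y))) : Y ⊕ Y → (Empty ⊕ (Fin N × Y)) ⊕ Y)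
    exact UniformFO.exists_tuple (UniformFO.forall_tuple (UniformFO.exists_finite hpair))
  obtain ⟨ψ, hψ⟩ := hE
  obtain ⟨r, ν, ψ₀, hν, hψ₀⟩ := exists_finite_variables_diag ψ
  have hEψ (M : Type) [L.Structure M] [Nonempty M] (b b' : Y → M) :
      ψ₀.Realize (Sum.elim (b ∘ ν) (b' ∘ ν)) ↔ E M b b' := by
    have := (hψ₀ M (Sum.elim b b')).symm.trans (hψ M (Sum.elim b b'))
    simpa [Sum.elim_comp_map] using this
  have hlift (M : Type) [Nonempty M] (x : Fin r → M) : ∃ b : Y → M, b ∘ ν = x :=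
    ⟨Function.extend ν x fun _ => Classical.arbitrary M, funext fun t => hν.extend_apply _ _ _⟩
  have hfin : FiniteEqRel L T r ψ₀ := by
    intro M _ _ hM
    refine ⟨⟨fun x => ?_, fun {x y} h => ?_, fun {x y z} h h' => ?_⟩, ?_⟩
    · obtain ⟨b, rfl⟩ := hlift M x
      exact (hEψ M b b).2 (hrefl.transfer hT M₀ M hM₀ hM heq.refl b)
    · obtain ⟨b, rfl⟩ := hlift M x
      obtain ⟨b', rfl⟩ := hlift M y
      rw [hEψ] at h ⊢
      exact hsymm.transfer hT M₀ M hM₀ hM (fun w => heq.symm) (Sum.elim b b') h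
    · obtain ⟨b, rfl⟩ := hlift M x
      obtain ⟨b', rfl⟩ := hlift M y
      obtain ⟨b'', rfl⟩ := hlift M z
      rw [hEψ] at h h' ⊢
      exact htrans.transfer hT M₀ M hM₀ hM (fun w => heq.trans)
        (fun t => (![b, b', b''] : Fin 3 → Y → M) t.1 t.2) h h'
    · obtain ⟨w, hw⟩ := hreps.transfer hT M₀ M hM₀ hM ⟨fun t => e t.1 t.2, he⟩
      refine ⟨N, fun i => (fun y => w (i, y)) ∘ ν, fun x => ?_⟩
      obtain ⟨b, rfl⟩ := hlift M x
      obtain ⟨i, hi⟩ := hw b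
      exact ⟨i, (hEψ M _ _).2 hi⟩
  obtain ⟨l, χ, hχ⟩ := hacl r ψ₀ hfin
  refine ⟨l, fun t => (χ t).relabel ν, fun M _ _ hM b b' => ?_⟩
  rw [← hEψ, hχ M hM]
  simp only [Formula.realize_relabel]

/-- In a stable theory with `acl(∅) = dcl(∅)`, every complete type over the empty set has generic
extensions that are definable over the empty set. -/
theorem exists_isGenericDef [Countable L.Symbols] [Finite ι] [Nonempty ι] (hT : T.IsComplete)
    (hst : IsStable L T) (hacl : AclEqDcl L T)
    (hsat : ∀ θ ∈ p, ∀ (M : Type) [L.Structure M] [Nonempty M], M ⊨ T → ∃ x : X → M, θ.Realize x)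
    (hne : p.Nonempty) (hinf : ∀ θ ∈ p, ∀ θ' ∈ p, θ ⊓ θ' ∈ p)
    (M₀ : Type) [L.Structure M₀] [Nonempty M₀] (hM₀ : M₀ ⊨ T) (φ : ι → L.Formula (X ⊕ Y)) :
    ∃ d : ι → L.Formula Y, IsGenericDef T p φ d := by
  classical
  obtain ⟨k, hk, hk'⟩ := exists_maximal_height hT hst hsat hne M₀ hM₀ φ
  obtain ⟨N, ⟨M, _, _, hM, e, he⟩, hmax⟩ := exists_maximal_pairwise_large hinf M₀ hM₀ hk'
  obtain ⟨θ₁, hθ₁, m₁, hθm⟩ := exists_uniform_width hne hinf hmax M hM he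
  let Q := instRel φ M
  let 𝓕 := definedSets p M
  have h𝓕 : ∀ S ∈ 𝓕, ∀ S' ∈ 𝓕, S ∩ S' ∈ 𝓕 := definedSets_inter hinf M
  have h𝓕ne : 𝓕.Nonempty := hne.image _
  have heq : Equivalence fun b b' : Y → M =>
      ¬ Wide Q m₁ k ({x | θ₁.Realize x} ∩ diffSet Q b b') := by
    simp only [Q, ← hθm]
    exact ⟨not_large_diffSet_self h𝓕ne, fun h => by rwa [diffSet_comm],
      fun h h' => not_large_diffSet_trans h𝓕 h h'⟩
  have hrep (b : Y → M) : ∃ i, ¬ Wide Q m₁ k ({x | θ₁.Realize x} ∩ diffSet Q b (e i)) := by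
    simp only [Q, ← hθm]
    exact exists_not_large_diffSet he (hmax M hM) b
  obtain ⟨r, χ, hχ⟩ := hacl.exists_formulas hT
    (UniformFO.wide_inter_diffSet φ θ₁ m₁ k).not (E := fun M _ b b' => ¬ Wide (instRel φ M) m₁ k
      ({x | θ₁.Realize x} ∩ diffSet (instRel φ M) b b')) M hM heq hrep
  have hlarge : Large Q k 𝓕 univ := by
    rintro _ ⟨θ, hθ, rfl⟩ m
    rw [inter_univ]
    exact hk θ hθ m M hM
  obtain ⟨s, hs⟩ := exists_large_patternCell h𝓕ne h𝓕 e hlarge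
  have hd (l : ι) : UniformFO (L := L) fun K _ (y : Y → K) =>
      ∃ i, s i l ∧ ∀ t, ((χ t).Realize y ↔ (χ t).Realize (e i)) :=
    UniformFO.exists_finite fun i => (UniformFO.const _).and <| UniformFO.forall_finite fun t =>
      (UniformFO.of_formula _).iff (UniformFO.const _)
  choose d hd using hd
  refine ⟨d, fun K _ _ hK θ hθ n b => ?_⟩
  have htr : UniformFO (L := L) fun K _ (_ : Empty → K) => ∀ b : Fin n × Y → K, ∃ x : X → K,
      θ.Realize x ∧ ∀ j l, (φ l).Realize (Sum.elim x fun y => b (j, y)) ↔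
        (d l).Realize fun y => b (j, y) := by
    have : UniformFO (L := L) fun K _ (w : (Empty ⊕ (Fin n × Y)) ⊕ X → K) =>
        θ.Realize (w ∘ Sum.inr) ∧ ∀ j l,
          (φ l).Realize (w ∘ Sum.elim Sum.inr fun y => Sum.inl (Sum.inr (j, y))) ↔
          (d l).Realize (w ∘ fun y => Sum.inl (Sum.inr (j, y))) :=
      ((UniformFO.of_formula θ).relabel _).and <| UniformFO.forall_finite fun j =>
        UniformFO.forall_finite fun l => ((UniformFO.of_formula (φ l)).relabel _).iff
          ((UniformFO.of_formula (d l)).relabel _)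
    refine (this.exists_tuple.forall_tuple).congr fun K _ _ v => ?_
    simp only [Sum.comp_elim]
    rfl
  refine htr.transfer hT M K hM hK (fun b => ?_) fun t => b t.1 t.2
  choose ρ hρ using fun j : Fin n => hrep fun y => b (j, y)
  have hgood : Large Q k 𝓕 (patternCell Q e s \ ⋃ j, diffSet Q (fun y => b (j, y)) (e (ρ j))) := by
    have h1 : Large Q k 𝓕 ((patternCell Q e s \ ⋃ j, diffSet Q (fun y => b (j, y)) (e (ρ j))) ∪
        ⋃ j, diffSet Q (fun y => b (j, y)) (e (ρ j))) :=
      hs.mono fun x hx => by rw [sdiff_union_self]; exact Or.inl hx.2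
    rcases h1.of_union h𝓕 with h | h
    · exact h
    · obtain ⟨j, hj⟩ := h.of_iUnion h𝓕ne h𝓕
      exact absurd ((hθm _ _).1 hj) (hρ j)
  obtain ⟨x, hx, hxs, hxd⟩ := hgood.inter_nonempty (mem_image_of_mem _ hθ)
  refine ⟨x, hx, fun j l => ?_⟩
  have hxj : (φ l).Realize (Sum.elim x fun y => b (j, y)) ↔ s (ρ j) l := by
    rw [← hxs (ρ j) l]
    by_contra hc
    exact hxd (mem_iUnion.2 ⟨j, l, hc⟩)
  rw [hxj, hd]
  simp only [← hχ M hM]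
  constructor
  · exact fun h => ⟨ρ j, h, hρ j⟩
  · rintro ⟨i, hi, hji⟩
    by_cases hij : i = ρ j
    · rwa [← hij]
    · exact absurd ((hθm _ _).1 (he i (ρ j) hij)) (heq.trans (heq.symm hji) (hρ j))

end FiniteEquivalence

section Symmetry

variable {L : FirstOrder.Language.{u, v}} {X Y ι κ : Type} {T : L.Theory}

theorem IsGenericDef.not_ladder (hst : IsStable L T) {p : Set (L.Formula X)}
    {q : Set (L.Formula Y)} {φ : ι → L.Formula (X ⊕ Y)} {d : ι → L.Formula Y}
    {ψ : κ → L.Formula (Y ⊕ X)} {e : κ → L.Formula X}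
    (hd : IsGenericDef T p φ d) (he : IsGenericDef T q ψ e) {l : ι} {l' : κ}
    (hφψ : ψ l' = (φ l).relabel Sum.swap) (M : Type) [L.Structure M] [Nonempty M] (hM : M ⊨ T)
    {θ : L.Formula X} (hθ : θ ∈ p) {η : L.Formula Y} (hη : η ∈ q) (c : Prop)
    (hθe : ∀ x : X → M, θ.Realize x → ((e l').Realize x ↔ ¬ c))
    (hηd : ∀ y : Y → M, η.Realize y → ((d l).Realize y ↔ c)) : False := by
  have hψ (x : X → M) (y : Y → M) :
      (ψ l').Realize (Sum.elim y x) ↔ (φ l).Realize (Sum.elim x y) := by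
    rw [hφψ, Formula.realize_relabel]
    congr!
    ext (x | y) <;> simp
  have hseq (n : ℕ) : ∃ (a : Fin n → X → M) (b : Fin n → Y → M), (∀ i, θ.Realize (a i)) ∧
      (∀ j, η.Realize (b j)) ∧ ∀ i j, (φ l).Realize (Sum.elim (a i) (b j)) ↔ (c ↔ j < i) := by
    induction n with
    | zero => exact ⟨Fin.elim0, Fin.elim0, nofun, nofun, nofun⟩
    | succ n ih =>
      obtain ⟨a, b, ha, hb, hab⟩ := ih
      obtain ⟨x, hx, hxb⟩ := hd M hM θ hθ n b
      have ha' : ∀ i, θ.Realize ((Fin.snoc a x : Fin (n + 1) → X → M) i) := fun i =>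
        Fin.lastCases (by simpa using hx) (fun i => by simpa using ha i) i
      obtain ⟨y, hy, hya⟩ := he M hM η hη (n + 1) (Fin.snoc a x)
      have hya' (i) : (φ l).Realize (Sum.elim ((Fin.snoc a x : Fin (n + 1) → X → M) i) y) ↔ ¬ c := by
        rw [← hψ, hya i l', hθe _ (ha' i)]
      refine ⟨Fin.snoc a x, Fin.snoc b y, ha', fun j =>
        Fin.lastCases (by simpa using hy) (fun j => by simpa using hb j) j, fun i j => ?_⟩
      refine Fin.lastCases ?_ (fun j => ?_) j
      · rw [Fin.snoc_last, hya' i]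
        simp [(Fin.le_last i).not_gt]
      · refine Fin.lastCases ?_ (fun i => ?_) i
        · rw [Fin.snoc_last, Fin.snoc_castSucc, hxb j l, hηd _ (hb j)]
          simp [Fin.castSucc_lt_last]
        · simpa using hab i j
  by_cases hc : c
  · obtain ⟨N, hN⟩ := hst.exists_no_ladder (φ l).not
    obtain ⟨a, b, -, -, hab⟩ := hseq N
    exact hN M hM a b fun i j => by simp [hab, hc]
  · obtain ⟨N, hN⟩ := hst.exists_no_ladder (φ l)
    obtain ⟨a, b, -, -, hab⟩ := hseq N
    exact hN M hM a b fun i j => by simp [hab, hc]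

/-- Symmetry of generic definitions of two types (Harrington's lemma). -/
theorem IsGenericDef.symmetry (hst : IsStable L T) {M₁ M₂ : Type} [L.Structure M₁]
    [L.Structure M₂] [Nonempty M₁] (hM₁ : M₁ ⊨ T) {a : X → M₁} {b : Y → M₂}
    {φ : ι → L.Formula (X ⊕ Y)} {d : ι → L.Formula Y}
    {ψ : κ → L.Formula (Y ⊕ X)} {e : κ → L.Formula X}
    (hd : IsGenericDef T {θ | θ.Realize a} φ d) (he : IsGenericDef T {η | η.Realize b} ψ e)
    {l : ι} {l' : κ} (hφψ : ψ l' = (φ l).relabel Sum.swap) :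
    (d l).Realize b ↔ (e l').Realize a := by
  by_contra hc
  by_cases h1 : (d l).Realize b
  · have h2 : ¬ (e l').Realize a := fun h' => hc (iff_of_true h1 h')
    exact hd.not_ladder hst he hφψ M₁ hM₁ (θ := (e l').not) (by simpa using h2) (η := d l)
      h1 True (by simp) (by simp)
  · have h2 : (e l').Realize a := by_contra fun h' => hc (iff_of_false h1 h')
    exact hd.not_ladder hst he hφψ M₁ hM₁ (θ := e l') h2 (η := (d l).not)
      (by simpa using h1) False (by simp) (by simp)

theorem exists_isGenericDef_tuple [Countable L.Symbols] [Finite ι] [Nonempty ι]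
    (hT : T.IsComplete) (hst : IsStable L T) (hacl : AclEqDcl L T) {M₁ : Type} [L.Structure M₁]
    [Nonempty M₁] (hM₁ : M₁ ⊨ T) (a : X → M₁) (φ : ι → L.Formula (X ⊕ Y)) :
    ∃ d : ι → L.Formula Y, IsGenericDef T {θ | θ.Realize a} φ d := by
  refine exists_isGenericDef hT hst hacl (p := {θ | θ.Realize a}) (fun θ hθ M _ _ hM => ?_)
    ⟨⊤, Formula.realize_top.2 trivial⟩
    (fun θ hθ θ' hθ' => Formula.realize_inf.2 ⟨hθ, hθ'⟩) M₁ hM₁ φ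
  exact (UniformFO.exists_tuple ((UniformFO.of_formula θ).relabel (Sum.inr : X → Empty ⊕ X))).transfer
    (Q := fun M _ => ∃ x : X → M, θ.Realize x) hT M₁ M hM₁ hM ⟨a, hθ⟩

end Symmetry

section JointType

variable {L : FirstOrder.Language.{u, v}} {T : L.Theory}

/-- Two models with automorphisms have a joint type that is invariant under the pair of
automorphisms. -/
theorem exists_invariant_joint_type [Countable L.Symbols] (hT : T.IsComplete) (hst : IsStable L T)
    (hacl : AclEqDcl L T) {M₁ M₂ : Type} [L.Structure M₁] [L.Structure M₂] [Nonempty M₁]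
    [Nonempty M₂] (hM₁ : M₁ ⊨ T) (hM₂ : M₂ ⊨ T) (σ₁ : M₁ ≃[L] M₁) (σ₂ : M₂ ≃[L] M₂) :
    ∃ (K : Type) (_ : L.Structure K) (_ : Nonempty K) (_ : K ⊨ T) (w : M₁ ⊕ M₂ → K),
      (∀ θ : L.Formula M₁, θ.Realize id → θ.Realize (w ∘ Sum.inl)) ∧
      (∀ η : L.Formula M₂, η.Realize id → η.Realize (w ∘ Sum.inr)) ∧
      ∀ φ : L.Formula (M₁ ⊕ M₂), φ.Realize w ↔ φ.Realize (w ∘ Sum.map σ₁ σ₂) := by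
  classical
  let Φ : Set (L.Formula (M₁ ⊕ M₂)) :=
    {χ | (∃ θ : L.Formula M₁, θ.Realize id ∧ χ = θ.relabel Sum.inl) ∨
      (∃ η : L.Formula M₂, η.Realize id ∧ χ = η.relabel Sum.inr) ∨
      ∃ φ : L.Formula (M₁ ⊕ M₂), χ = φ.iff (φ.relabel (Sum.map σ₁ σ₂))}
  have hfin (Φ₀ : Finset (L.Formula (M₁ ⊕ M₂))) (hΦ₀ : (Φ₀ : Set _) ⊆ Φ) :
      ∃ (θ : L.Formula M₁) (n : ℕ) (g : Fin (n + 1) → L.Formula (M₁ ⊕ M₂)), θ.Realize id ∧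
        ∀ x : M₁ → M₂, θ.Realize x → (∀ t, (g t).Realize (Sum.elim x id) ↔
          ((g t).relabel (Sum.map σ₁ σ₂)).Realize (Sum.elim x id)) →
          ∀ χ ∈ Φ₀, χ.Realize (Sum.elim x id) := by
    induction Φ₀ using Finset.induction_on with
    | empty => exact ⟨⊤, 0, fun _ => ⊤, by simp, by simp⟩
    | insert χ Φ₀ _ ih =>
      rw [Finset.coe_insert, insert_subset_iff] at hΦ₀
      obtain ⟨θ, n, g, hθ, h⟩ := ih hΦ₀.2
      simp only [Finset.forall_mem_insert]
      rcases hΦ₀.1 with ⟨θ', hθ', rfl⟩ | ⟨η, hη, rfl⟩ | ⟨φ, rfl⟩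
      · refine ⟨θ ⊓ θ', n, g, Formula.realize_inf.2 ⟨hθ, hθ'⟩, fun x hx hg => ⟨?_, ?_⟩⟩
        · rw [Formula.realize_relabel, Sum.elim_comp_inl]
          exact (Formula.realize_inf.1 hx).2
        · exact h x (Formula.realize_inf.1 hx).1 hg
      · refine ⟨θ, n, g, hθ, fun x hx hg => ⟨?_, h x hx hg⟩⟩
        rwa [Formula.realize_relabel, Sum.elim_comp_inr]
      · refine ⟨θ, n + 1, Fin.cons φ g, hθ, fun x hx hg => ⟨?_, h x hx fun t => ?_⟩⟩
        · exact Formula.realize_iff.2 (hg 0)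
        · exact hg t.succ
  obtain ⟨K, sK, nK, hK, w, hw⟩ := exists_realization T Φ fun Φ₀ hΦ₀ => by
    obtain ⟨θ, n, g, hθ, h⟩ := hfin Φ₀ hΦ₀
    let fam : Fin (n + 1) × Bool → L.Formula (M₁ ⊕ M₂) := fun t =>
      if t.2 then g t.1 else (g t.1).relabel (Sum.map σ₁ σ₂)
    obtain ⟨d, hd⟩ := exists_isGenericDef_tuple hT hst hacl hM₁ id fam
    obtain ⟨e, he⟩ := exists_isGenericDef_tuple hT hst hacl hM₂ id
      fun t => (g t).relabel Sum.swap
    have he' : IsGenericDef T {η : L.Formula M₂ | η.Realize id}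
        (fun t => ((g t).relabel (Sum.map σ₁ σ₂)).relabel Sum.swap)
        fun t => (e t).relabel σ₁ := by
      intro M _ _ hM η hη r a
      obtain ⟨y, hy, hya⟩ := he M hM (η.relabel σ₂.symm) (by
        simp only [mem_ofPred_eq, Formula.realize_relabel] at hη ⊢
        exact (StrongHomClass.realize_formula σ₂.symm η).2 hη) r fun j => a j ∘ σ₁
      refine ⟨y ∘ σ₂.symm, Formula.realize_relabel.1 hy, fun j l => ?_⟩
      have hya' := hya j l
      simp only [Formula.realize_relabel] at hya' ⊢
      rw [← hya']
      congr!
      ext (t | t) <;> simp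
    have hdd (t) : (d (t, true)).Realize id ↔ (d (t, false)).Realize id := by
      rw [hd.symmetry hst hM₁ he (l := (t, true)) (l' := t) rfl,
        hd.symmetry hst hM₁ he' (l := (t, false)) (l' := t) rfl, Formula.realize_relabel]
      exact (StrongHomClass.realize_formula σ₁ (e t)).symm
    obtain ⟨x, hx, hxd⟩ := hd M₂ hM₂ θ hθ 1 fun _ => id
    refine ⟨M₂, inferInstance, inferInstance, hM₂, Sum.elim x id, h x hx fun t => ?_⟩
    have h1 := hxd 0 (t, true)
    have h2 := hxd 0 (t, false)
    rw [← hdd t] at h2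
    exact h1.trans h2.symm
  refine ⟨K, sK, nK, hK, w, fun θ hθ => ?_, fun η hη => ?_, fun φ => ?_⟩
  · exact Formula.realize_relabel.1 (hw _ (Or.inl ⟨θ, hθ, rfl⟩))
  · exact Formula.realize_relabel.1 (hw _ (Or.inr (Or.inl ⟨η, hη, rfl⟩)))
  · have := hw _ (Or.inr (Or.inr ⟨φ, rfl⟩))
    rwa [Formula.realize_iff, Formula.realize_relabel] at this

end JointType

section Automorphism

variable {L : FirstOrder.Language.{u, v}}

/-- A map satisfying the elementary diagram of its domain is an elementary embedding. -/
def elementaryOfDiagram {K K' : Type} [L.Structure K] [L.Structure K'] (h : K → K')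
    (hh : ∀ ψ : L.Formula K, ψ.Realize id → ψ.Realize h) : K ↪ₑ[L] K' where
  toFun := h
  map_formula' n φ x := by
    have key (φ : L.Formula (Fin n)) (hφ : φ.Realize x) : φ.Realize (h ∘ x) := by
      have := hh (φ.relabel x) (by rwa [Formula.realize_relabel])
      rwa [Formula.realize_relabel] at this
    refine ⟨fun h1 => ?_, key φ⟩
    by_contra h2
    exact Formula.realize_not.1 (key φ.not (Formula.realize_not.2 h2)) h1

/-- Two structures with tuples of the same type have a common elementary extension in which
the tuples are identified. -/
theorem exists_amalgam [Countable L.Symbols] {X K K' : Type} [L.Structure K] [L.Structure K']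
    [Nonempty K] [Nonempty K'] (p : X → K) (q : X → K')
    (hpq : ∀ φ : L.Formula X, φ.Realize p ↔ φ.Realize q) :
    ∃ (N : Type) (_ : L.Structure N) (_ : Nonempty N) (h : K ↪ₑ[L] N) (h' : K' ↪ₑ[L] N),
      ∀ x, h (p x) = h' (q x) := by
  let Φ : Set (L.Formula (K ⊕ K')) :=
    {ψ | ∃ θ : L.Formula K, θ.Realize id ∧ θ.relabel Sum.inl = ψ} ∪
    {ψ | ∃ φ : L.Formula (X ⊕ K'), φ.Realize (Sum.elim q id) ∧ φ.relabel (Sum.map p id) = ψ}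
  obtain ⟨N, sN, nN, -, w, hw⟩ := exists_realization (∅ : L.Theory) Φ (by
    intro Φ₀ hΦ₀
    have key : ∃ φ : L.Formula (X ⊕ K'), φ.Realize (Sum.elim q id) ∧
        ∀ y : K' → K, φ.Realize (Sum.elim p y) → ∀ ψ ∈ Φ₀, ψ.Realize (Sum.elim id y) := by
      classical
      induction Φ₀ using Finset.induction_on with
      | empty => exact ⟨⊤, by simp [Formula.Realize], by simp⟩
      | insert ψ s _ ih =>
        simp only [Finset.coe_insert, Set.insert_subset_iff] at hΦ₀
        obtain ⟨φ, hφ, hs⟩ := ih hΦ₀.2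
        rcases hΦ₀.1 with ⟨θ, hθ, rfl⟩ | ⟨φ', hφ', rfl⟩
        · refine ⟨φ, hφ, fun y hy ψ hψ => ?_⟩
          rcases Finset.mem_insert.1 hψ with rfl | hψ
          · rwa [Formula.realize_relabel, Sum.elim_comp_inl]
          · exact hs y hy ψ hψ
        · refine ⟨φ ⊓ φ', Formula.realize_inf.2 ⟨hφ, hφ'⟩, fun y hy ψ hψ => ?_⟩
          have hy := Formula.realize_inf.1 hy
          rcases Finset.mem_insert.1 hψ with rfl | hψ
          · rw [Formula.realize_relabel, Sum.elim_comp_map]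
            exact hy.2
          · exact hs y hy.1 ψ hψ
    obtain ⟨φ, hφ, h⟩ := key
    obtain ⟨χ, hχ⟩ := (UniformFO.of_formula φ).exists_tuple
    obtain ⟨y, hy⟩ := (hχ K p).1 ((hpq χ).2 ((hχ K' q).2 ⟨id, hφ⟩))
    exact ⟨K, inferInstance, inferInstance, by simp, Sum.elim id y, h y hy⟩)
  refine ⟨N, sN, nN, elementaryOfDiagram (w ∘ Sum.inl) fun θ hθ => ?_,
    elementaryOfDiagram (w ∘ Sum.inr) fun η hη => ?_, fun x => ?_⟩
  · exact Formula.realize_relabel.1 (hw _ (Or.inl ⟨θ, hθ, rfl⟩))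
  · have := hw _ (Or.inr ⟨η.relabel Sum.inr, ?_, rfl⟩)
    · rw [Formula.realize_relabel, Formula.realize_relabel] at this
      exact this
    · rwa [Formula.realize_relabel, Sum.elim_comp_inr]
  · have := hw _ (Or.inr ⟨Term.equal (Term.var (Sum.inl x)) (Term.var (Sum.inr (q x))), ?_, rfl⟩)
    · rw [Formula.realize_relabel] at this
      exact Formula.realize_equal.1 this
    · simp [Formula.realize_equal]

section Limit

variable {G : ℕ → Type} [∀ n, L.Structure (G n)]
  (j : ∀ n, G n ↪ₑ[L] G (n + 1))

theorem natLERec_self {m : ℕ} (x : G m) :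
    DirectedSystem.natLERec (fun n => (j n).toEmbedding) m m le_rfl x = x := by
  simp only [DirectedSystem.coe_natLERec]
  exact Nat.leRecOn_self x

theorem natLERec_succ {m n : ℕ} (h : m ≤ n) (x : G m) :
    DirectedSystem.natLERec (fun n => (j n).toEmbedding) m (n + 1) (h.trans n.le_succ) x =
      j n (DirectedSystem.natLERec (fun n => (j n).toEmbedding) m n h x) := by
  simp only [DirectedSystem.coe_natLERec]
  exact Nat.leRecOn_succ h _

theorem realize_natLERec {α : Type*} {k m n : ℕ} (h : m ≤ n) (φ : L.BoundedFormula α k)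
    (a : α → G m) (xs : Fin k → G m) :
    φ.Realize (DirectedSystem.natLERec (fun n => (j n).toEmbedding) m n h ∘ a)
      (DirectedSystem.natLERec (fun n => (j n).toEmbedding) m n h ∘ xs) ↔ φ.Realize a xs := by
  induction n, h using Nat.le_induction with
  | base =>
    have : (DirectedSystem.natLERec (fun n => (j n).toEmbedding) m m le_rfl : G m → G m) = id :=
      funext (natLERec_self j)
    rw [this]; rfl
  | succ n h ih =>
    rw [← ih, ← (j n).map_boundedFormula φ]
    have : (DirectedSystem.natLERec (fun n => (j n).toEmbedding) m (n + 1) (h.trans n.le_succ) :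
        G m → G (n + 1)) =
          j n ∘ DirectedSystem.natLERec (fun n => (j n).toEmbedding) m n h :=
      funext fun _ => natLERec_succ j h _
    rw [this]; rfl

theorem realize_directLimit_of {α : Type} {k m : ℕ} (φ : L.BoundedFormula α k)
    (a : α → G m) (xs : Fin k → G m) :
    φ.Realize
      (DirectLimit.of L ℕ G (DirectedSystem.natLERec fun n => (j n).toEmbedding) m ∘ a)
      (DirectLimit.of L ℕ G (DirectedSystem.natLERec fun n => (j n).toEmbedding) m ∘ xs) ↔
        φ.Realize a xs := by
  induction φ generalizing m with
  | falsum => rfl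
  | equal t₁ t₂ =>
    simp only [BoundedFormula.Realize, ← Sum.comp_elim, HomClass.realize_term]
    exact (DirectLimit.of L ℕ G _ m).injective.eq_iff
  | rel R ts =>
    simp only [BoundedFormula.Realize, ← Sum.comp_elim, HomClass.realize_term]
    exact (DirectLimit.of L ℕ G _ m).map_rel R _
  | imp φ ψ ih₁ ih₂ => simp only [BoundedFormula.realize_imp, ih₁, ih₂]
  | all φ ih =>
    constructor
    · intro h x
      have := h (DirectLimit.of L ℕ G _ m x)
      rwa [← Fin.comp_snoc, ih] at this
    · intro h z
      obtain ⟨i, x, rfl⟩ := DirectLimit.exists_of z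
      rw [← realize_natLERec j (le_max_left m i)] at h
      have := h (DirectedSystem.natLERec (fun n => (j n).toEmbedding) i _ (le_max_right m i) x)
      rw [← ih, Fin.comp_snoc, DirectLimit.of_f] at this
      have hof {β : Type} (b : β → G m) :
          DirectLimit.of L ℕ G (DirectedSystem.natLERec fun n => (j n).toEmbedding) (max m i) ∘
            DirectedSystem.natLERec (fun n => (j n).toEmbedding) m _ (le_max_left m i) ∘ b =
          DirectLimit.of L ℕ G (DirectedSystem.natLERec fun n => (j n).toEmbedding) m ∘ b :=
        funext fun _ => Language.DirectLimit.of_f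
      rwa [hof, hof] at this

end Limit

/-- The union of an elementary chain, with the map induced by a compatible sequence of elementary
embeddings shifting the chain. -/
theorem exists_chain_limit {G : ℕ → Type} [∀ n, L.Structure (G n)]
    (j g : ∀ n, G n ↪ₑ[L] G (n + 1)) (hjg : ∀ n x, g (n + 1) (j n x) = j (n + 1) (g n x)) :
    ∃ (N : Type) (_ : L.Structure N) (ι : ∀ n, G n ↪ₑ[L] N) (τ : N ↪ₑ[L] N),
      (∀ n x, ι (n + 1) (j n x) = ι n x) ∧ (∀ n x, τ (ι n x) = ι (n + 1) (g n x)) ∧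
      ∀ z, ∃ n x, ι n x = z := by
  let f := DirectedSystem.natLERec fun n => (j n).toEmbedding
  let ι (n : ℕ) : G n ↪ₑ[L] Language.DirectLimit G f :=
    ⟨DirectLimit.of L ℕ G f n, fun _ φ x => by
      have := realize_directLimit_of j φ x default
      rw [Subsingleton.elim (_ ∘ default) default] at this
      exact this⟩
  have hf (n) (x : G n) : f n (n + 1) n.le_succ x = j n x := by
    rw [natLERec_succ j le_rfl, natLERec_self]
  have hι (n) (x : G n) : ι (n + 1) (j n x) = ι n x := by
    rw [← hf]
    exact DirectLimit.of_f
  let τ₀ := Language.DirectLimit.lift L ℕ G f (fun n => ((ι (n + 1)).comp (g n)).toEmbedding) (by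
    intro m n h x
    induction n, h using Nat.le_induction with
    | base => rw [natLERec_self]
    | succ n h ih =>
      rw [← ih, natLERec_succ j h]
      change ι (n + 2) (g (n + 1) (j n _)) = ι (n + 1) (g n _)
      rw [hjg, hι])
  have hτ₀ (n) (x : G n) : τ₀ (ι n x) = ι (n + 1) (g n x) := Language.DirectLimit.lift_of ..
  refine ⟨Language.DirectLimit G f, inferInstance, ι, ⟨τ₀, fun n φ x => ?_⟩, hι, hτ₀, fun z => ?_⟩
  · obtain ⟨m, y, rfl⟩ := DirectLimit.exists_quotient_mk'_sigma_mk'_eq G f x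
    change φ.Realize (τ₀ ∘ ι m ∘ y) ↔ φ.Realize (ι m ∘ y)
    have : τ₀ ∘ ι m ∘ y = ι (m + 1) ∘ g m ∘ y := funext fun _ => hτ₀ ..
    rw [this, (ι m).map_formula, (ι (m + 1)).map_formula, (g m).map_formula]
  · exact DirectLimit.exists_of z

variable (L) in
/-- A pair of elementary embeddings between two structures. -/
structure ElementaryPair where
  dom : Type
  cod : Type
  [domStr : L.Structure dom]
  [codStr : L.Structure cod]
  nonempty_cod : Nonempty cod
  incl : dom ↪ₑ[L] cod
  shift : dom ↪ₑ[L] cod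

attribute [instance] ElementaryPair.domStr ElementaryPair.codStr

theorem ElementaryPair.exists_next [Countable L.Symbols] (s : ElementaryPair L) :
    ∃ (N : Type) (_ : L.Structure N) (_ : Nonempty N) (g j : s.cod ↪ₑ[L] N),
      ∀ x, g (s.incl x) = j (s.shift x) := by
  have := s.nonempty_cod
  exact exists_amalgam s.incl s.shift fun φ => by
    rw [← Function.comp_id s.incl, ← Function.comp_id s.shift, s.incl.map_formula,
      s.shift.map_formula]

/-- A pair on the codomain of `s` whose second map extends that of `s`. -/
noncomputable def ElementaryPair.next [Countable L.Symbols] (s : ElementaryPair L) :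
    ElementaryPair L where
  dom := s.cod
  cod := s.exists_next.choose
  codStr := s.exists_next.choose_spec.choose
  nonempty_cod := s.exists_next.choose_spec.choose_spec.choose
  shift := s.exists_next.choose_spec.choose_spec.choose_spec.choose
  incl := s.exists_next.choose_spec.choose_spec.choose_spec.choose_spec.choose

theorem ElementaryPair.next_shift_incl [Countable L.Symbols] (s : ElementaryPair L) (x : s.dom) :
    s.next.shift (s.incl x) = s.next.incl (s.shift x) :=
  s.exists_next.choose_spec.choose_spec.choose_spec.choose_spec.choose_spec x

/-- The sequence of pairs obtained from `s` by iterating `next`. -/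
noncomputable def ElementaryPair.chain [Countable L.Symbols] (s : ElementaryPair L) :
    ℕ → ElementaryPair L
  | 0 => s
  | n + 1 => (s.chain n).next

/-- An elementary self-embedding extends to an automorphism of an elementary extension. -/
theorem exists_bijective_extension {K : Type} [L.Structure K] (τ : K ↪ₑ[L] K) :
    ∃ (N : Type) (_ : L.Structure N) (e : K ↪ₑ[L] N) (ρ : N ↪ₑ[L] N),
      Function.Bijective ρ ∧ ∀ x, ρ (e x) = e (τ x) := by
  obtain ⟨N, sN, ι, ρ, hι, hρ, hN⟩ := exists_chain_limit (G := fun _ => K) (fun _ => τ)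
    (fun _ => τ.comp τ) fun _ _ => rfl
  have h (n x) : ρ (ι n x) = ι n (τ x) := (hρ n x).trans (hι n _)
  refine ⟨N, sN, ι 0, ρ, ⟨ρ.injective, fun z => ?_⟩, h 0⟩
  obtain ⟨n, x, rfl⟩ := hN z
  exact ⟨ι (n + 1) x, by rw [h, hι]⟩

/-- A type-preserving map of a family of elements is induced by an automorphism of some
elementary extension. -/
theorem exists_automorphism_extension [Countable L.Symbols] {X K : Type} [L.Structure K]
    [Nonempty K] (w : X → K) (s : X → X)
    (hw : ∀ φ : L.Formula X, φ.Realize w ↔ φ.Realize (w ∘ s)) :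
    ∃ (N : Type) (_ : L.Structure N) (e : K ↪ₑ[L] N) (ρ : N ↪ₑ[L] N),
      Function.Bijective ρ ∧ ∀ x, ρ (e (w x)) = e (w (s x)) := by
  obtain ⟨K₁, _, _, g, j, hgj⟩ := exists_amalgam w (w ∘ s) hw
  let c := ElementaryPair.chain ⟨K, K₁, inferInstance, j, g⟩
  obtain ⟨K', _, ι, τ, hι, hτ, -⟩ := exists_chain_limit (G := fun n => (c n).dom)
    (fun n => (c n).incl) (fun n => (c n).shift) fun n => (c n).next_shift_incl
  obtain ⟨N, sN, e, ρ, hρ, he⟩ := exists_bijective_extension τ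
  refine ⟨N, sN, e.comp (ι 0), ρ, hρ, fun x => ?_⟩
  exact (he _).trans (congrArg e ((hτ 0 (w x)).trans
    ((congrArg (ι 1) (hgj x)).trans (hι 0 (w (s x))))))

end Automorphism

section JointEmbedding

variable {L : FirstOrder.Language.{u, v}}

theorem IsTsigmaModel.exists_equiv [L.IsRelational] {T : L.Theory} {M : Type}
    [(Lsig L).Structure M] (hM : IsTsigmaModel L T M) :
    letI := redL L M
    ∃ σ : M ≃[L] M, ∀ x, σ x = sigmaMap L M x := by
  let := redL L M
  exact ⟨⟨Equiv.ofBijective _ hM.2.1, fun f => isEmptyElim f, fun R x => hM.2.2 _ R x⟩,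
    fun _ => rfl⟩

/-- The expansion of an `L`-structure by a unary function interpreting `σ`. -/
abbrev expandBy (N : Type) [L.Structure N] (ρ : N → N) : (Lsig L).Structure N where
  funMap {n} f x := match n, f with
    | _, .inl f => funMap f x
    | 0, .inr f => nomatch (show Empty from f)
    | 1, .inr _ => ρ (x 0)
    | _ + 2, .inr f => nomatch (show Empty from f)
  RelMap R x := Sum.elim (fun R : L.Relations _ => RelMap R x) (fun _ => True) R

theorem isTsigmaModel_expandBy {T : L.Theory} {N : Type} [L.Structure N] (hN : N ⊨ T)
    (ρ : N ↪ₑ[L] N) (hρ : Function.Bijective ρ) :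
    @IsTsigmaModel L T N (expandBy N ρ) :=
  ⟨hN, hρ, fun _ R x => ρ.map_rel R x⟩

/-- An `L`-embedding into `N` commuting with `σ` is an `L_σ`-embedding into the expansion. -/
theorem nonempty_embedding_expandBy [L.IsRelational] {M N : Type} [(Lsig L).Structure M]
    [L.Structure N] (ρ : N → N) (h : letI := redL L M; M ↪[L] N)
    (hρ : ∀ x, ρ (h x) = h (sigmaMap L M x)) :
    letI := expandBy (L := L) N ρ
    Nonempty (M ↪[Lsig L] N) := by
  let := redL L M
  let := expandBy (L := L) N ρ
  refine ⟨⟨h.toEmbedding, fun {n} f x => ?_, fun {n} R x => ?_⟩⟩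
  · match n, f with
    | _, .inl f => exact isEmptyElim f
    | 0, .inr f => exact nomatch (show Empty from f)
    | 1, .inr f =>
      obtain ⟨a, rfl⟩ : ∃ a, x = ![a] := ⟨x 0, funext fun i => by rw [Subsingleton.elim i 0]; rfl⟩
      exact (hρ a).symm
    | _ + 2, .inr f => exact nomatch (show Empty from f)
  · match R with
    | .inl R => exact h.map_rel R x
    | .inr R => exact nomatch (show Empty from R)

end JointEmbedding

/-- Fact `fact0` 2: if `T` is stable and `acl(∅) = dcl(∅)` in `C^eq_T`,
then `T_σ` has the joint embedding property. -/
theorem jep_of_aclEqDcl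
    (L : FirstOrder.Language) [L.IsRelational] [Countable L.Symbols]
    (T : L.Theory) (hcomp : T.IsComplete) (hstable : IsStable L T)
    (hacl : AclEqDcl L T) :
    ∀ (M₁ M₂ : Type) [(Lsig L).Structure M₁] [(Lsig L).Structure M₂]
      [Nonempty M₁] [Nonempty M₂],
      IsTsigmaModel L T M₁ → IsTsigmaModel L T M₂ →
        ∃ (N : Type) (_ : (Lsig L).Structure N) (_ : Nonempty N),
          IsTsigmaModel L T N ∧
          Nonempty (M₁ ↪[Lsig L] N) ∧ Nonempty (M₂ ↪[Lsig L] N) := by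
  intro M₁ M₂ _ _ _ _ hM₁ hM₂
  let := redL L M₁
  let := redL L M₂
  obtain ⟨σ₁, hσ₁⟩ := hM₁.exists_equiv
  obtain ⟨σ₂, hσ₂⟩ := hM₂.exists_equiv
  obtain ⟨K, _, _, hK, w, hw₁, hw₂, hw⟩ :=
    exists_invariant_joint_type hcomp hstable hacl hM₁.1 hM₂.1 σ₁ σ₂
  obtain ⟨N, _, e, ρ, hρ, he⟩ := exists_automorphism_extension w (Sum.map σ₁ σ₂) hw
  refine ⟨N, expandBy N ρ, ‹Nonempty K›.map e,
    isTsigmaModel_expandBy ((e.theory_model_iff T).1 hK) ρ hρ,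
    nonempty_embedding_expandBy ρ (e.comp (elementaryOfDiagram _ hw₁)).toEmbedding fun x => ?_,
    nonempty_embedding_expandBy ρ (e.comp (elementaryOfDiagram _ hw₂)).toEmbedding fun x => ?_⟩
  · rw [← hσ₁]
    exact he (.inl x)
  · rw [← hσ₂]
    exact he (.inr x)

end PaperAut
end

section
/- Let L contain binary relation symbols E and R and unary predicates P_i for i < ω, and let T assert: E is an equivalence relation with infinitely many infinite classes; R refines each E-class into two-element classes; and each P_i holds only of elements of a single E-class and contains exactly one element from each R-class of that E-class. Then T_σ does not have a model companion. -/
namespace PaperAut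

open FirstOrder Language Structure Set

variable (L : FirstOrder.Language)

variable {L}

variable (L)

variable (L : FirstOrder.Language)

/-! ### The example: `E`, `R`, and predicates `P_i` -/

/-- Relations of the example language: unary `P_i` (`i : ℕ`) and two binary relations. -/
def exRels : ℕ → Type
  | 1 => ℕ
  | 2 => Bool
  | _ => Empty

/-- The example language, with binary `E`, `R` and unary `P_i` for `i < ω`. -/
def exLang : FirstOrder.Language := ⟨fun _ => Empty, exRels⟩

def Esym : exLang.Relations 2 := true
def Rsym : exLang.Relations 2 := false
def Psym (i : ℕ) : exLang.Relations 1 := i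

def Esat {M : Type*} [exLang.Structure M] (x y : M) : Prop :=
  Structure.RelMap Esym ![x, y]
def Rsat {M : Type*} [exLang.Structure M] (x y : M) : Prop :=
  Structure.RelMap Rsym ![x, y]
def Psat {M : Type*} [exLang.Structure M] (i : ℕ) (x : M) : Prop :=
  Structure.RelMap (Psym i) ![x]

/-- `M` is a model of the example theory `T`: `E` is an equivalence relation with
infinitely many infinite classes, refined by `R` into two-element classes, and each `P_i`
holds only of elements of one `E`-class and contains exactly one element from each
`R`-class of that `E`-class. -/
def IsExModel (M : Type*) [exLang.Structure M] : Prop :=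
  Equivalence (Esat (M := M)) ∧
  (∀ k : ℕ, ∃ x : Fin k → M,
    (∀ i j, i ≠ j → ¬ Esat (x i) (x j)) ∧ ∀ i, {y : M | Esat (x i) y}.Infinite) ∧
  Equivalence (Rsat (M := M)) ∧
  (∀ x y : M, Rsat x y → Esat x y) ∧
  (∀ x : M, ∃ y : M, y ≠ x ∧ Rsat x y ∧ ∀ z : M, Rsat x z → z = x ∨ z = y) ∧
  (∀ (i : ℕ) (x y : M), Psat i x → Psat i y → Esat x y) ∧
  (∀ i : ℕ, ∃ x : M, Psat i x) ∧
  (∀ (i : ℕ) (x : M), Psat i x → ∀ y : M, Esat x y → ∃! z : M, Rsat y z ∧ Psat i z)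

/-- `M` is a model of `T_σ` for the example theory. -/
def IsExSigmaModel (M : Type*) [(Lsig exLang).Structure M] : Prop :=
  (letI := redL exLang M; IsExModel M) ∧
  Function.Bijective (sigmaMap exLang M) ∧
  (letI := redL exLang M;
    ∀ (r : ℕ) (R : exLang.Relations r) (x : Fin r → M),
      Structure.RelMap R (sigmaMap exLang M ∘ x) ↔ Structure.RelMap R x)

/-- The formula `ψ(x,y,z) : E(x,z) ∧ E(y,z) ∧ R(x,y) ∧ x ≠ y`, semantically. -/
def PsiSat {M : Type*} [(Lsig exLang).Structure M] (x y z : M) : Prop :=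
  letI := redL exLang M
  Esat x z ∧ Esat y z ∧ Rsat x y ∧ x ≠ y

section SigmaStructures

variable {M N : Type}

/-- The relation `E` of an `L_σ`-structure. -/
def eRel [(Lsig exLang).Structure M] (x y : M) : Prop :=
  RelMap (L := Lsig exLang) (Sum.inl Esym) ![x, y]

/-- The relation `R` of an `L_σ`-structure. -/
def rRel [(Lsig exLang).Structure M] (x y : M) : Prop :=
  RelMap (L := Lsig exLang) (Sum.inl Rsym) ![x, y]

/-- The predicate `P_i` of an `L_σ`-structure. -/
def pRel [(Lsig exLang).Structure M] (i : ℕ) (x : M) : Prop :=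
  RelMap (L := Lsig exLang) (Sum.inl (Psym i)) ![x]

/-- The `L_σ`-structure with prescribed interpretations of `E`, `R`, the `P_i` and `σ`. -/
@[reducible] def mkStructure (E R : M → M → Prop) (P : ℕ → M → Prop) (s : M → M) :
    (Lsig exLang).Structure M where
  funMap := fun {n} f x => match n, f, x with
    | 1, Sum.inr _, x => s (x 0)
  RelMap := fun {n} r x => match n, r, x with
    | 1, Sum.inl i, x => P i (x 0)
    | 2, Sum.inl true, x => E (x 0) (x 1)
    | 2, Sum.inl false, x => R (x 0) (x 1)

/-- Relations of `L_σ` are determined by `E`, `R` and the `P_i`. -/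
theorem relMap_congr [(Lsig exLang).Structure M] [(Lsig exLang).Structure N] (f : M → N)
    (hE : ∀ x y, eRel (f x) (f y) ↔ eRel x y) (hR : ∀ x y, rRel (f x) (f y) ↔ rRel x y)
    (hP : ∀ i x, pRel i (f x) ↔ pRel i x) :
    ∀ (n : ℕ) (r : (Lsig exLang).Relations n) (x : Fin n → M),
      RelMap r (f ∘ x) ↔ RelMap r x
  | 0, Sum.inl r, _ => r.elim
  | 1, Sum.inl i, x => by
      have h1 : x = ![x 0] := by ext j; fin_cases j; rfl
      have h2 : f ∘ x = ![f (x 0)] := by ext j; fin_cases j; rfl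
      rw [h2, h1]
      exact hP i (x 0)
  | 2, Sum.inl b, x => by
      have h1 : x = ![x 0, x 1] := by ext j; fin_cases j <;> rfl
      have h2 : f ∘ x = ![f (x 0), f (x 1)] := by ext j; fin_cases j <;> rfl
      rw [h2, h1]
      cases b
      · exact hR (x 0) (x 1)
      · exact hE (x 0) (x 1)
  | _ + 3, Sum.inl r, _ => r.elim
  | _, Sum.inr r, _ => r.elim

/-- An injection respecting `E`, `R`, the `P_i` and `σ` is an embedding. -/
def embeddingOf [(Lsig exLang).Structure M] [(Lsig exLang).Structure N] (f : M → N)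
    (hf : Function.Injective f)
    (hE : ∀ x y, eRel (f x) (f y) ↔ eRel x y) (hR : ∀ x y, rRel (f x) (f y) ↔ rRel x y)
    (hP : ∀ i x, pRel i (f x) ↔ pRel i x)
    (hσ : ∀ x, f (sigmaMap exLang M x) = sigmaMap exLang N (f x)) :
    M ↪[Lsig exLang] N where
  toFun := f
  inj' := hf
  map_fun' := fun {n} g x => match n, g, x with
    | 1, Sum.inr _, x => by
      have h1 : x = ![x 0] := by ext j; fin_cases j; rfl
      have h2 : f ∘ x = ![f (x 0)] := by ext j; fin_cases j; rfl
      rw [h2, h1]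
      exact hσ (x 0)
  map_rel' := fun {n} r x => relMap_congr f hE hR hP n r x

variable [(Lsig exLang).Structure M] [(Lsig exLang).Structure N]

theorem eRel_map (g : M ↪[Lsig exLang] N) (x y : M) : eRel (g x) (g y) ↔ eRel x y := by
  have h : g ∘ ![x, y] = ![g x, g y] := by ext j; fin_cases j <;> rfl
  have := g.map_rel (Sum.inl Esym) ![x, y]
  rwa [h] at this

theorem rRel_map (g : M ↪[Lsig exLang] N) (x y : M) : rRel (g x) (g y) ↔ rRel x y := by
  have h : g ∘ ![x, y] = ![g x, g y] := by ext j; fin_cases j <;> rfl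
  have := g.map_rel (Sum.inl Rsym) ![x, y]
  rwa [h] at this

theorem pRel_map (g : M ↪[Lsig exLang] N) (i : ℕ) (x : M) : pRel i (g x) ↔ pRel i x := by
  have h : g ∘ ![x] = ![g x] := by ext j; fin_cases j; rfl
  have := g.map_rel (Sum.inl (Psym i)) ![x]
  rwa [h] at this

theorem sigmaMap_map (g : M ↪[Lsig exLang] N) (x : M) :
    g (sigmaMap exLang M x) = sigmaMap exLang N (g x) := by
  have h : g ∘ ![x] = ![g x] := by ext j; fin_cases j; rfl
  have := g.map_fun (Sum.inr sigSymb) ![x]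
  rwa [h] at this

theorem IsExSigmaModel.eRel_sigmaMap (h : IsExSigmaModel M) (x y : M) :
    eRel (sigmaMap exLang M x) (sigmaMap exLang M y) ↔ eRel x y := by
  have e : sigmaMap exLang M ∘ ![x, y] = ![sigmaMap exLang M x, sigmaMap exLang M y] := by
    ext j; fin_cases j <;> rfl
  have := h.2.2 2 Esym ![x, y]
  rwa [e] at this

theorem IsExSigmaModel.rRel_sigmaMap (h : IsExSigmaModel M) (x y : M) :
    rRel (sigmaMap exLang M x) (sigmaMap exLang M y) ↔ rRel x y := by
  have e : sigmaMap exLang M ∘ ![x, y] = ![sigmaMap exLang M x, sigmaMap exLang M y] := by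
    ext j; fin_cases j <;> rfl
  have := h.2.2 2 Rsym ![x, y]
  rwa [e] at this

theorem IsExSigmaModel.pRel_sigmaMap (h : IsExSigmaModel M) (i : ℕ) (x : M) :
    pRel i (sigmaMap exLang M x) ↔ pRel i x := by
  have e : sigmaMap exLang M ∘ ![x] = ![sigmaMap exLang M x] := by
    ext j; fin_cases j; rfl
  have := h.2.2 1 (Psym i) ![x]
  rwa [e] at this

/-- `z` lies in the `E`-class of some point moved by `σ` within its own `R`-class. -/
def SwapNear (z : M) : Prop :=
  ∃ x : M, eRel x z ∧ rRel x (sigmaMap exLang M x) ∧ x ≠ sigmaMap exLang M x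

theorem SwapNear.map (g : M ↪[Lsig exLang] N) {z : M} (h : SwapNear z) : SwapNear (g z) := by
  obtain ⟨x, hE, hR, hne⟩ := h
  refine ⟨g x, (eRel_map g x z).2 hE, ?_, ?_⟩
  · rw [← sigmaMap_map, rRel_map]
    exact hR
  · rw [← sigmaMap_map]
    exact fun e => hne (g.injective e)

/-- No point in the `E`-class of a predicate `P_i` is swapped with its `R`-partner. -/
theorem IsExSigmaModel.not_swapNear (h : IsExSigmaModel M) {i : ℕ} {z : M} (hz : pRel i z) :
    ¬ SwapNear z := by
  rintro ⟨x, hE, hR, hne⟩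
  obtain ⟨⟨eqE, -, eqR, -, two, -, -, uniq⟩, bij, -⟩ := id h
  obtain ⟨w, ⟨hw, hPw⟩, hu⟩ := uniq i z hz x (eqE.symm hE)
  have hσw : sigmaMap exLang M w = w :=
    hu _ ⟨eqR.trans hR ((h.rRel_sigmaMap x w).2 hw), (h.pRel_sigmaMap i w).2 hPw⟩
  obtain ⟨y, -, -, hy⟩ := two x
  have h1 : y = sigmaMap exLang M x := by
    rcases hy _ hR with e | e
    · exact (hne e.symm).elim
    · exact e.symm
  rcases hy _ hw with e | e
  · rw [e] at hσw
    exact hne hσw.symm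
  · have hwx : w = sigmaMap exLang M x := e.trans h1
    exact hne ((bij.1 (hσw.trans hwx)).symm.trans hwx)

/-- The term `σ(t)`. -/
def sigmaTerm {α : Type} (t : (Lsig exLang).Term α) : (Lsig exLang).Term α :=
  Functions.apply₁ (L := Lsig exLang) (Sum.inr sigSymb) t

theorem realize_sigmaTerm {α : Type} (t : (Lsig exLang).Term α) (v : α → M) :
    (sigmaTerm t).realize v = sigmaMap exLang M (t.realize v) :=
  Term.realize_functions_apply₁

/-- The formula expressing `SwapNear`. -/
def swapNearFormula : (Lsig exLang).Formula (Fin 1) :=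
  BoundedFormula.ex (n := 0)
    ((Relations.boundedFormula₂ (L := Lsig exLang) (n := 1) (Sum.inl Esym)
        (Term.var (Sum.inr 0)) (Term.var (Sum.inl 0)) ⊓
      Relations.boundedFormula₂ (L := Lsig exLang) (n := 1) (Sum.inl Rsym)
        (Term.var (Sum.inr 0)) (sigmaTerm (Term.var (Sum.inr 0)))) ⊓
      ∼(Term.bdEqual (Term.var (Sum.inr 0)) (sigmaTerm (Term.var (Sum.inr 0)))))

theorem realize_swapNearFormula (v : Fin 1 → M) :
    swapNearFormula.Realize v ↔ SwapNear (v 0) := by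
  refine BoundedFormula.realize_ex.trans (exists_congr fun x => ?_)
  rw [BoundedFormula.realize_inf, BoundedFormula.realize_inf, and_assoc]
  refine and_congr BoundedFormula.realize_rel₂
    (and_congr (BoundedFormula.realize_rel₂.trans ?_) (not_congr ?_))
  · rw [realize_sigmaTerm]
    rfl
  · rw [BoundedFormula.realize_bdEqual, realize_sigmaTerm]
    rfl

/-- The formula `E(x, y)`. -/
def eFormula : (Lsig exLang).Formula (Fin 2) :=
  Relations.formula₂ (L := Lsig exLang) (Sum.inl Esym) (Term.var 0) (Term.var 1)

theorem realize_eFormula (v : Fin 2 → M) : eFormula.Realize v ↔ eRel (v 0) (v 1) :=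
  Formula.realize_rel₂

/-- The formula `P_i(x)`. -/
def pFormula (i : ℕ) : (Lsig exLang).Formula (Fin 1) :=
  Relations.formula₁ (L := Lsig exLang) (Sum.inl (Psym i)) (Term.var 0)

theorem realize_pFormula (i : ℕ) (v : Fin 1 → M) : (pFormula i).Realize v ↔ pRel i (v 0) :=
  Formula.realize_rel₁

/-- The formula `σ(x) = x`. -/
def fixFormula : (Lsig exLang).Formula (Fin 1) :=
  Term.equal (sigmaTerm (Term.var 0)) (Term.var 0)

theorem realize_fixFormula (v : Fin 1 → M) :
    fixFormula.Realize v ↔ sigmaMap exLang M (v 0) = v 0 := by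
  rw [fixFormula, Formula.realize_equal, realize_sigmaTerm]
  rfl

end SigmaStructures

section BaseModel

/-- The model with carrier `ℕ × ℕ × Bool` in which `P_i` picks a point from each `R`-class
of the `i`-th `E`-class, and `σ` is the identity. -/
instance baseStructure : (Lsig exLang).Structure (ℕ × ℕ × Bool) :=
  mkStructure (fun x y => x.1 = y.1) (fun x y => x.1 = y.1 ∧ x.2.1 = y.2.1)
    (fun i x => x.1 = i ∧ x.2.2 = true) id

theorem baseStructure_isExSigmaModel : IsExSigmaModel (ℕ × ℕ × Bool) := by
  refine ⟨⟨?_, ?_, ?_, ?_, ?_, ?_, ?_, ?_⟩, Function.bijective_id, fun _ _ _ => Iff.rfl⟩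
  · exact ⟨fun _ => rfl, fun h => Eq.symm h, fun h h' => Eq.trans h h'⟩
  · intro k
    refine ⟨fun i => (i, 0, true), fun i j hij h => hij (Fin.ext h), fun i => ?_⟩
    refine Set.infinite_of_injective_forall_mem (f := fun n : ℕ => ((i : ℕ), n, true)) ?_ ?_
    · intro a b hab
      simpa using hab
    · exact fun n => rfl
  · exact ⟨fun _ => ⟨rfl, rfl⟩, fun h => ⟨h.1.symm, h.2.symm⟩,
      fun h h' => ⟨h.1.trans h'.1, h.2.trans h'.2⟩⟩
  · exact fun _ _ h => h.1
  · rintro ⟨a, b, c⟩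
    refine ⟨(a, b, !c), by simp, ⟨rfl, rfl⟩, ?_⟩
    rintro ⟨a', b', c'⟩ ⟨h1, h2⟩
    change a = a' at h1
    change b = b' at h2
    subst h1 h2
    cases c <;> cases c' <;> simp
  · exact fun i x y hx hy => hx.1.trans hy.1.symm
  · exact fun i => ⟨(i, 0, true), rfl, rfl⟩
  · rintro i ⟨a, b, c⟩ ⟨h1, h2⟩ ⟨a', b', c'⟩ h3
    change a = i at h1
    change a = a' at h3
    subst h1 h3
    refine ⟨(a, b', true), ⟨⟨rfl, rfl⟩, rfl, rfl⟩, ?_⟩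
    rintro ⟨a'', b'', c''⟩ ⟨⟨h4, h5⟩, h6, h7⟩
    change b' = b'' at h5
    change a'' = a at h6
    change c'' = true at h7
    simp [h5, h6, h7]

end BaseModel

section SwapExtension

variable {M : Type} [(Lsig exLang).Structure M]

/-- The map collapsing two new points onto `z`. -/
def collapse (z : M) : M ⊕ Bool → M := Sum.elim id fun _ => z

/-- The extension of `M` by a new `R`-class in the `E`-class of `z` whose two points are
swapped by `σ`. -/
@[reducible] def swapExtension (z : M) : (Lsig exLang).Structure (M ⊕ Bool) :=
  mkStructure (fun u v => eRel (collapse z u) (collapse z v))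
    (Sum.LiftRel rRel fun _ _ => True)
    (fun i => Sum.elim (pRel i) fun _ => False)
    (Sum.map (sigmaMap exLang M) not)

/-- The inclusion of `M` into `swapExtension z`. -/
def swapInclusion (z : M) :
    letI := swapExtension z
    M ↪[Lsig exLang] (M ⊕ Bool) :=
  letI := swapExtension z
  embeddingOf Sum.inl Sum.inl_injective (fun _ _ => Iff.rfl)
    (fun _ _ => Sum.liftRel_inl_inl) (fun _ _ => Iff.rfl) (fun _ => rfl)

theorem swapExtension_swapNear (hE : IsExSigmaModel M) (z : M) :
    letI := swapExtension z
    SwapNear (Sum.inl z : M ⊕ Bool) :=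
  let _ := swapExtension z
  ⟨Sum.inr true, hE.1.1.refl z, Sum.LiftRel.inr trivial, fun e => Bool.noConfusion (Sum.inr.inj e)⟩

theorem swapExtension_isExSigmaModel (h : IsExSigmaModel M) {z : M}
    (hz : sigmaMap exLang M z = z) (hP : ∀ i x, pRel i x → ¬ eRel x z) :
    @IsExSigmaModel (M ⊕ Bool) (swapExtension z) := by
  let _ := swapExtension z
  obtain ⟨⟨eqE, inf, eqR, sub, two, oneE, exP, uniq⟩, bij, -⟩ := id h
  have hσ (u : M ⊕ Bool) :
      collapse z (Sum.map (sigmaMap exLang M) not u) = sigmaMap exLang M (collapse z u) := by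
    rcases u with x | b
    · rfl
    · exact hz.symm
  refine ⟨⟨?_, ?_, ?_, ?_, ?_, ?_, ?_, ?_⟩, ?_, ?_⟩
  · exact ⟨fun u => eqE.refl (collapse z u), fun h => eqE.symm h, fun h h' => eqE.trans h h'⟩
  · intro k
    obtain ⟨x, hx, hx'⟩ := inf k
    refine ⟨fun i => Sum.inl (x i), hx, fun i => ?_⟩
    refine ((hx' i).image Sum.inl_injective.injOn).mono ?_
    rintro _ ⟨y, hy, rfl⟩
    exact hy
  · refine ⟨?_, ?_, ?_⟩
    · rintro (x | b)
      · exact Sum.LiftRel.inl (eqR.refl x)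
      · exact Sum.LiftRel.inr trivial
    · rintro _ _ (⟨hh⟩ | ⟨-⟩)
      · exact Sum.LiftRel.inl (eqR.symm hh)
      · exact Sum.LiftRel.inr trivial
    · rintro _ _ _ (⟨hh⟩ | ⟨-⟩) (⟨hh'⟩ | ⟨-⟩)
      · exact Sum.LiftRel.inl (eqR.trans hh hh')
      · exact Sum.LiftRel.inr trivial
  · rintro _ _ (⟨hh⟩ | ⟨-⟩)
    · exact sub _ _ hh
    · exact eqE.refl z
  · rintro (x | b)
    · obtain ⟨y, hne, hxy, hy⟩ := two x
      refine ⟨Sum.inl y, fun e => hne (Sum.inl.inj e), Sum.LiftRel.inl hxy, ?_⟩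
      rintro _ (⟨hh⟩ | -)
      exact (hy _ hh).imp (congrArg _) (congrArg _)
    · refine ⟨Sum.inr !b, by simp, Sum.LiftRel.inr trivial, ?_⟩
      rintro _ (- | @⟨_, c, -⟩)
      cases b <;> cases c <;> simp
  · rintro i (x | b) (y | c) hx hy
    · exact oneE i x y hx hy
    · exact hy.elim
    · exact hx.elim
    · exact hx.elim
  · intro i
    obtain ⟨x, hx⟩ := exP i
    exact ⟨Sum.inl x, hx⟩
  · rintro i (x | b) hx (y | c) hxy
    · obtain ⟨w, ⟨hw, hPw⟩, hu⟩ := uniq i x hx y hxy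
      refine ⟨Sum.inl w, ⟨Sum.LiftRel.inl hw, hPw⟩, ?_⟩
      rintro _ ⟨⟨hh⟩ | -, hP'⟩
      exact congrArg _ (hu _ ⟨hh, hP'⟩)
    · exact (hP i x hx hxy).elim
    · exact hx.elim
    · exact hx.elim
  · exact ⟨bij.1.sumMap Bool.involutive_not.injective,
      bij.2.sumMap Bool.involutive_not.surjective⟩
  · intro n r x
    refine relMap_congr (sigmaMap exLang (M ⊕ Bool)) (fun u v => ?_) (fun u v => ?_)
      (fun i u => ?_) n (Sum.inl r) x
    · change eRel (collapse z (Sum.map (sigmaMap exLang M) not u))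
        (collapse z (Sum.map (sigmaMap exLang M) not v)) ↔ eRel (collapse z u) (collapse z v)
      rw [hσ, hσ]
      exact h.eRel_sigmaMap _ _
    · change Sum.LiftRel _ _ (Sum.map (sigmaMap exLang M) not u)
        (Sum.map (sigmaMap exLang M) not v) ↔ Sum.LiftRel _ _ u v
      rcases u with u | u <;> rcases v with v | v <;> simp [h.rRel_sigmaMap]
    · rcases u with u | u
      · exact h.pRel_sigmaMap i u
      · exact Iff.rfl

end SwapExtension

/-- for the example theory `T`, `T_σ` has no model companion. -/
theorem example_no_modelCompanion :
    ¬ ∃ T' : (Lsig exLang).Theory,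
      IsModelComplete T' ∧
      (∀ (M : Type) [(Lsig exLang).Structure M] [Nonempty M], IsExSigmaModel M →
        ∃ (N : Type) (_ : (Lsig exLang).Structure N), Nonempty N ∧ (N ⊨ T') ∧
          Nonempty (M ↪[Lsig exLang] N)) ∧
      (∀ (N : Type) [(Lsig exLang).Structure N] [Nonempty N], N ⊨ T' →
        ∃ (M : Type) (_ : (Lsig exLang).Structure M), Nonempty M ∧ IsExSigmaModel M ∧
          Nonempty (N ↪[Lsig exLang] M)) := by
  rintro ⟨T', modelComplete, toCompanion, ofCompanion⟩
  obtain ⟨N, _, _, hN, ⟨g⟩⟩ := toCompanion _ baseStructure_isExSigmaModel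
  obtain ⟨M, _, _, hM, ⟨f⟩⟩ := ofCompanion N hN
  let p (i : ℕ) : N := g (i, 0, true)
  have hp (i : ℕ) : pRel i (p i) := (pRel_map g i _).2 ⟨rfl, rfl⟩
  have hpE {i j : ℕ} (hij : i ≠ j) : ¬ eRel (p i) (p j) :=
    fun h => hij ((eRel_map g _ _).1 h)
  have hpσ (i : ℕ) : sigmaMap exLang N (p i) = p i := (sigmaMap_map g _).symm
  have hpS (i : ℕ) : ¬ SwapNear (p i) := fun h =>
    hM.not_swapNear ((pRel_map f i (p i)).2 (hp i)) (h.map f)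
  let u : Ultrafilter ℕ := Filter.hyperfilter ℕ
  let U : Type := (u : Filter ℕ).Product fun _ => N
  have hU : U ⊨ T' := (Theory.model_iff T').2 fun φ hφ =>
    (Ultraproduct.sentence_realize φ).2 (Filter.Eventually.of_forall fun _ =>
      Theory.realize_sentence_of_mem T' hφ)
  let z : U := Quotient.mk' (s := (u : Filter ℕ).productSetoid fun _ => N) p
  let q (i : ℕ) : U := Quotient.mk' (s := (u : Filter ℕ).productSetoid fun _ => N) fun _ => p i
  have hz : sigmaMap exLang U z = z := by
    refine (realize_fixFormula fun _ => z).1 ?_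
    refine (Ultraproduct.realize_formula_cast (u := u) fixFormula fun _ => p).2 ?_
    exact Filter.Eventually.of_forall fun i => (realize_fixFormula _).2 (hpσ i)
  have hzS : ¬ SwapNear z := by
    intro h
    obtain ⟨i, hi⟩ := ((Ultraproduct.realize_formula_cast (u := u) swapNearFormula
      fun _ => p).1 ((realize_swapNearFormula fun _ => z).2 h)).exists
    exact hpS i ((realize_swapNearFormula _).1 hi)
  have hqz (i : ℕ) : ¬ eRel (q i) z := by
    intro h
    have h1 := (Ultraproduct.realize_formula_cast (u := u) eFormula
      (![fun _ => p i, p] : Fin 2 → ℕ → N)).1 ((realize_eFormula _).2 h)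
    have h2 : ∀ᶠ j in (u : Filter ℕ), j = i := h1.mono fun j hj => by
      by_contra hne
      exact hpE (Ne.symm hne) ((realize_eFormula _).1 hj)
    exact Filter.notMem_hyperfilter_of_finite (Set.finite_singleton i) h2
  have hq (i : ℕ) : pRel i (q i) := by
    refine (realize_pFormula i fun _ => q i).1 ?_
    refine (Ultraproduct.realize_formula_cast (u := u) (pFormula i) fun _ _ => p i).2 ?_
    exact Filter.Eventually.of_forall fun _ => (realize_pFormula i _).2 (hp i)
  obtain ⟨M', _, _, hM', ⟨f'⟩⟩ := ofCompanion U hU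
  have hfz : sigmaMap exLang M' (f' z) = f' z := by rw [← sigmaMap_map, hz]
  have hPz (i : ℕ) (x : M') (hx : pRel i x) : ¬ eRel x (f' z) := fun h =>
    hqz i ((eRel_map f' _ _).1
      (hM'.1.1.trans (hM'.1.2.2.2.2.2.1 i _ _ ((pRel_map f' i _).2 (hq i)) hx) h))
  let _ := swapExtension (f' z)
  obtain ⟨N', _, _, hN', ⟨g'⟩⟩ := toCompanion _ (swapExtension_isExSigmaModel hM' hfz hPz)
  have hS : SwapNear (g' (Sum.inl (f' z))) := (swapExtension_swapNear hM' (f' z)).map g'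
  refine hzS ((realize_swapNearFormula fun _ => z).1 ?_)
  refine (modelComplete U N' hU hN' (g'.comp ((swapInclusion (f' z)).comp f')) 1 _ _).1 ?_
  exact (realize_swapNearFormula _).2 hS

end PaperAut
end
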